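/- arXiv:1512.02051 — 5 statements merged into one kernel-verified Lean document; each statement's English description precedes it below -/
import Mathlib

section
/- Let a_1, …, a_s be positive integers, let q > max{a_1, …, a_s} be an integer, and let t be a positive integer. Then F_v(2_t, a_1, …, a_s; q + t) ≤ F_v(a_1, …, a_s; q) + t. -/
/-- `G →v (a₁, …, aₛ)`: for every coloring of the vertices of `G` with `s` colors there is a
color `i` and a monochromatic clique of size `aᵢ` in color `i`. The list `a` records
`a₁, …, aₛ`. -/
def VArrow {V : Type*} (G : SimpleGraph V) (a : List ℕ) : Prop :=
  ∀ c : V → Fin a.length, ∃ i : Fin a.length, ∃ s : Finset V,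
    G.IsNClique (a.get i) s ∧ ∀ v ∈ s, c v = i

/-- The vertex Folkman number `F_v(a₁, …, aₛ; q)`: the minimum number of vertices of a
`K_q`-free graph `G` with `G →v (a₁, …, aₛ)`. -/
noncomputable def folkman (a : List ℕ) (q : ℕ) : ℕ :=
  sInf {n : ℕ | ∃ G : SimpleGraph (Fin n), G.CliqueFree q ∧ VArrow G a}

/-- `VArrow` with the clique sizes given by a family instead of a list. -/
def FamilyVArrow {V ι : Type*} (G : SimpleGraph V) (a : ι → ℕ) : Prop :=
  ∀ c : V → ι, ∃ i : ι, ∃ s : Finset V, G.IsNClique (a i) s ∧ ∀ v ∈ s, c v = i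

theorem FamilyVArrow.of_embedding {V W ι : Type*} {G : SimpleGraph V} {H : SimpleGraph W}
    {a : ι → ℕ} (h : FamilyVArrow G a) (f : G ↪g H) : FamilyVArrow H a := by
  intro c
  obtain ⟨i, s, hs, hc⟩ := h (c ∘ f)
  refine ⟨i, s.map f.toEmbedding, ?_, by simpa using hc⟩
  refine ⟨?_, by simpa using hs.card_eq⟩
  intro x hx y hy hxy
  simp only [Finset.coe_map, Set.mem_image, Finset.mem_coe] at hx hy
  obtain ⟨v, hv, rfl⟩ := hx
  obtain ⟨w, hw, rfl⟩ := hy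
  exact f.map_adj_iff.2 (hs.isClique hv hw fun e => hxy (by rw [e]))

/-- A finite graph can be moved to `Fin n`, where `n` is the number of its vertices. -/
theorem exists_fin_familyVArrow {V ι : Type*} [Fintype V] {G : SimpleGraph V} {a : ι → ℕ}
    {q n : ℕ} (hn : Fintype.card V = n) (hfree : G.CliqueFree q) (harrow : FamilyVArrow G a) :
    ∃ H : SimpleGraph (Fin n), H.CliqueFree q ∧ FamilyVArrow H a := by
  let e : Fin n ≃ V := (Fintype.equivFinOfCardEq hn).symm
  let φ : G.comap e ≃g G := SimpleGraph.Iso.comap e G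
  exact ⟨G.comap e, hfree.comap ⟨φ.toCopy⟩, harrow.of_embedding φ.symm.toEmbedding⟩

section Amalgam

variable {s : ℕ} {n : Fin s → ℕ} {Y : Type*}

/-- An independent set `Y` together with one copy of every `G j` for each injection `e` of the
vertex sets of `G j` into `Y`; the vertex `e K`, for `K` a clique of size `b j`, is joined to `K`
in the copy indexed by `e`. -/
def amalgam (G : ∀ j, SimpleGraph (Fin (n j))) (b : Fin s → ℕ) (Y : Type*) :
    SimpleGraph (Y ⊕ Σ j, (Finset (Fin (n j)) ↪ Y) × Fin (n j)) where
  Adj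
    | .inl _, .inl _ => False
    | .inl y, .inr x => ∃ K, (G x.1).IsNClique (b x.1) K ∧ x.2.1 K = y ∧ x.2.2 ∈ K
    | .inr x, .inl y => ∃ K, (G x.1).IsNClique (b x.1) K ∧ x.2.1 K = y ∧ x.2.2 ∈ K
    | .inr x, .inr y => ∃ j e v w, x = ⟨j, e, v⟩ ∧ y = ⟨j, e, w⟩ ∧ (G j).Adj v w
  symm := ⟨by
    rintro (x | x) (y | y) h
    · exact h
    · exact h
    · exact h
    · obtain ⟨j, e, v, w, rfl, rfl, h⟩ := h
      exact ⟨j, e, w, v, rfl, rfl, h.symm⟩⟩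
  loopless := ⟨by
    rintro (x | x) h
    · exact h
    · obtain ⟨j, e, v, w, rfl, h, hadj⟩ := h
      simp only [Sigma.mk.injEq, heq_eq_eq, Prod.mk.injEq, true_and] at h
      exact hadj.ne h⟩

/-- The inclusion of the copy of `G j` indexed by `e`. -/
def amalgamCopy (G : ∀ j, SimpleGraph (Fin (n j))) (b : Fin s → ℕ) (j : Fin s)
    (e : Finset (Fin (n j)) ↪ Y) : G j ↪g amalgam G b Y where
  toFun v := .inr ⟨j, e, v⟩
  inj' v w h := by simpa using h
  map_rel_iff' {v w} := by
    constructor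
    · rintro ⟨j', e', v', w', h₁, h₂, h⟩
      obtain rfl : j = j' := congrArg Sigma.fst h₁
      simp only [Sigma.mk.injEq, heq_eq_eq, Prod.mk.injEq, true_and] at h₁ h₂
      rwa [h₁.2, h₂.2]
    · intro h
      exact ⟨j, e, v, w, rfl, rfl, h⟩

theorem mem_range_amalgamCopy {G : ∀ j, SimpleGraph (Fin (n j))} {b : Fin s → ℕ} {j : Fin s}
    {e : Finset (Fin (n j)) ↪ Y} {v : Fin (n j)} {S : Set _}
    (hS : (amalgam G b Y).IsClique S) (hv : .inr ⟨j, e, v⟩ ∈ S) {x : Sigma _}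
    (hx : .inr x ∈ S) : ∃ w, x = ⟨j, e, w⟩ := by
  by_cases h : (.inr ⟨j, e, v⟩ : Y ⊕ Σ j, (Finset (Fin (n j)) ↪ Y) × Fin (n j)) = .inr x
  · exact ⟨v, (Sum.inr_injective h).symm⟩
  · obtain ⟨j', e', v', w, h₁, rfl, -⟩ := hS hv hx h
    obtain rfl : j = j' := congrArg Sigma.fst h₁
    simp only [Sigma.mk.injEq, heq_eq_eq, Prod.mk.injEq, true_and] at h₁
    exact ⟨w, by rw [h₁.1]⟩

theorem amalgam_cliqueFree {G : ∀ j, SimpleGraph (Fin (n j))} {b : Fin s → ℕ} {q : ℕ}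
    (hq : 2 ≤ q) (hb : ∀ j, b j + 1 < q) (hG : ∀ j, (G j).CliqueFree q) :
    (amalgam G b Y).CliqueFree q := by
  classical
  intro S hS
  by_cases hy : ∃ y, .inl y ∈ S
  · obtain ⟨y, hy⟩ := hy
    have hcard : (S.erase (.inl y)).card = q - 1 := by
      rw [Finset.card_erase_of_mem hy, hS.card_eq]
    have hinr : ∀ x ∈ S.erase (.inl y), (amalgam G b Y).Adj (.inl y) x := fun x hx =>
      hS.isClique hy (Finset.mem_of_mem_erase hx) (Finset.ne_of_mem_erase hx).symm
    obtain ⟨x, hx⟩ : (S.erase (.inl y)).Nonempty := Finset.card_pos.1 (by omega)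
    obtain x | ⟨j, e, v⟩ := x
    · exact hinr _ hx
    obtain ⟨K, hK, hKy, -⟩ := hinr _ hx
    have hsub : S.erase (.inl y) ⊆ K.map (amalgamCopy G b j e).toEmbedding := by
      intro x' hx'
      obtain x' | x' := x'
      · exact (hinr _ hx').elim
      obtain ⟨w, rfl⟩ := mem_range_amalgamCopy hS.isClique (Finset.mem_of_mem_erase hx)
        (Finset.mem_of_mem_erase hx')
      obtain ⟨K', -, hKy', hw⟩ := hinr _ hx'
      obtain rfl : K' = K := e.injective (hKy'.trans hKy.symm)
      exact Finset.mem_map_of_mem _ hw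
    have hle := Finset.card_le_card hsub
    have hKcard : K.card = b j := hK.card_eq
    rw [Finset.card_map] at hle
    have := hb j
    omega
  · obtain ⟨x, hx⟩ : S.Nonempty := Finset.card_pos.1 (by rw [hS.card_eq]; omega)
    obtain x | ⟨j, e, v⟩ := x
    · exact hy ⟨x, hx⟩
    let f := amalgamCopy G b j e
    have hmap : (S.preimage f f.injective.injOn).map f.toEmbedding = S := by
      ext x'
      simp only [Finset.mem_map, Finset.mem_preimage]
      constructor
      · rintro ⟨w, hw, rfl⟩
        exact hw
      · intro hx'
        obtain x' | x' := x'
        · exact (hy ⟨x', hx'⟩).elim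
        obtain ⟨w, rfl⟩ := mem_range_amalgamCopy hS.isClique hx hx'
        exact ⟨w, hx', rfl⟩
    refine hG j (S.preimage f f.injective.injOn) ⟨?_, ?_⟩
    · intro v hv w hw hvw
      simp only [Finset.coe_preimage, Set.mem_preimage, Finset.mem_coe] at hv hw
      exact f.map_adj_iff.1 (hS.isClique hv hw (f.injective.ne hvw))
    · rw [← Finset.card_map f.toEmbedding, hmap, hS.card_eq]

theorem amalgam_familyVArrow [Fintype Y] [NeZero s] {G : ∀ j, SimpleGraph (Fin (n j))}
    {a : Fin s → ℕ} (ha : ∀ j, 0 < a j)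
    (hG : ∀ j, FamilyVArrow (G j) (Function.update a j (a j - 1)))
    (hY : s * ∑ j, 2 ^ n j ≤ Fintype.card Y) :
    FamilyVArrow (amalgam G (fun j => a j - 1) Y) a := by
  classical
  intro c
  obtain ⟨j, hj⟩ := Fintype.exists_le_card_fiber_of_mul_le_card (fun y => c (.inl y))
    (by simpa using hY)
  have hle : Fintype.card (Finset (Fin (n j))) ≤
      Fintype.card {y : Y // c (.inl y) = j} := by
    rw [Fintype.card_finset, Fintype.card_fin, Fintype.card_subtype]
    exact (Finset.single_le_sum (f := fun j => 2 ^ n j) (fun _ _ => Nat.zero_le _)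
      (Finset.mem_univ j)).trans hj
  obtain ⟨e₀⟩ := Function.Embedding.nonempty_of_card_le hle
  let e : Finset (Fin (n j)) ↪ Y := e₀.trans (Function.Embedding.subtype _)
  have he : ∀ K, c (.inl (e K)) = j := fun K => (e₀ K).2
  let f := amalgamCopy G (fun j => a j - 1) j e
  obtain ⟨i, K, hK, hc⟩ := hG j (c ∘ f)
  have hmap : (amalgam G (fun j => a j - 1) Y).IsClique (K.map f.toEmbedding) := by
    intro x hx y hy hxy
    simp only [Finset.coe_map, Set.mem_image, Finset.mem_coe] at hx hy
    obtain ⟨v, hv, rfl⟩ := hx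
    obtain ⟨w, hw, rfl⟩ := hy
    exact f.map_adj_iff.2 (hK.isClique hv hw fun e => hxy (by rw [e]))
  obtain rfl | hij := eq_or_ne i j
  · rw [Function.update_self] at hK
    have hnot : .inl (e K) ∉ K.map f.toEmbedding := by
      simp only [Finset.mem_map, not_exists, not_and]
      rintro v - h
      exact Sum.inr_ne_inl h
    refine ⟨i, insert (.inl (e K)) (K.map f.toEmbedding), ⟨?_, ?_⟩, ?_⟩
    · rw [Finset.coe_insert, SimpleGraph.isClique_insert]
      refine ⟨hmap, fun x hx _ => ?_⟩
      obtain ⟨v, hv, rfl⟩ := Finset.mem_map.1 hx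
      exact ⟨K, hK, rfl, hv⟩
    · rw [Finset.card_insert_of_notMem hnot, Finset.card_map, hK.card_eq]
      have := ha i
      omega
    · intro x hx
      obtain rfl | hx := Finset.mem_insert.1 hx
      · exact he K
      · obtain ⟨v, hv, rfl⟩ := Finset.mem_map.1 hx
        exact hc v hv
  · rw [Function.update_of_ne hij] at hK
    refine ⟨i, K.map f.toEmbedding, ⟨hmap, by rw [Finset.card_map, hK.card_eq]⟩, ?_⟩
    intro x hx
    obtain ⟨v, hv, rfl⟩ := Finset.mem_map.1 hx
    exact hc v hv

end Amalgam

/-- **Folkman's theorem** for vertex colorings. -/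
theorem exists_cliqueFree_familyVArrow {s : ℕ} [NeZero s] {q : ℕ} (a : Fin s → ℕ)
    (hq : ∀ i, a i < q) :
    ∃ n, ∃ G : SimpleGraph (Fin n), G.CliqueFree q ∧ FamilyVArrow G a := by
  induction hm : ∑ i, a i using Nat.strong_induction_on generalizing a with
  | _ m ih =>
    by_cases hpos : ∀ j, 0 < a j
    · have hstep : ∀ j, ∃ n, ∃ G : SimpleGraph (Fin n), G.CliqueFree q ∧
          FamilyVArrow G (Function.update a j (a j - 1)) := by
        intro j
        have hle : ∀ i, Function.update a j (a j - 1) i ≤ a i := by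
          intro i
          obtain rfl | hij := eq_or_ne i j
          · simp
          · simp [hij]
        refine ih _ ?_ _ (fun i => (hle i).trans_lt (hq i)) rfl
        rw [← hm]
        refine Finset.sum_lt_sum (fun i _ => hle i) ⟨j, Finset.mem_univ j, ?_⟩
        have := hpos j
        rw [Function.update_self]
        omega
      choose n G hfree harrow using hstep
      have h₂ : 2 ≤ q := by
        have := hpos 0
        have := hq 0
        omega
      refine ⟨_, exists_fin_familyVArrow rfl (amalgam_cliqueFree h₂ (fun j => ?_) hfree)
        (amalgam_familyVArrow (Y := Fin (s * ∑ j, 2 ^ n j)) hpos harrow (by simp))⟩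
      have := hpos j
      have := hq j
      omega
    · push Not at hpos
      obtain ⟨j, hj⟩ := hpos
      refine ⟨0, ⊥, ?_, fun c => ⟨j, ∅, ?_, by simp⟩⟩
      · exact SimpleGraph.cliqueFree_of_card_lt (by simpa using (Nat.zero_le _).trans_lt (hq j))
      · simp [SimpleGraph.isNClique_iff, Nat.le_zero.1 hj]

/-- The graph `G` with one new vertex joined to all of its vertices. -/
def cone {V : Type*} (G : SimpleGraph V) : SimpleGraph (Option V) where
  Adj
    | none, none => False
    | none, some _ => True
    | some _, none => True
    | some v, some w => G.Adj v w
  symm := ⟨by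
    rintro (_ | v) (_ | w) h
    · exact h
    · exact h
    · exact h
    · exact SimpleGraph.Adj.symm (G := G) h⟩
  loopless := ⟨by
    rintro (_ | v) h
    · exact h
    · exact G.loopless.irrefl v h⟩

theorem isClique_cone_map_some {V : Type*} {G : SimpleGraph V} {s : Finset V}
    (hs : G.IsClique s) : (cone G).IsClique (s.map .some : Finset (Option V)) := by
  intro x hx y hy hxy
  simp only [Finset.coe_map, Set.mem_image, Finset.mem_coe] at hx hy
  obtain ⟨v, hv, rfl⟩ := hx
  obtain ⟨w, hw, rfl⟩ := hy
  exact hs hv hw fun e => hxy (by rw [e])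

theorem cone_cliqueFree {V : Type*} {G : SimpleGraph V} {q : ℕ} (h : G.CliqueFree q) :
    (cone G).CliqueFree (q + 1) := by
  intro S hS
  have hle : q ≤ S.eraseNone.card := by
    have hcard := hS.card_eq
    by_cases hnone : none ∈ S
    · rw [Finset.card_eraseNone_of_mem hnone]
      omega
    · rw [Finset.card_eraseNone_of_not_mem hnone]
      omega
  obtain ⟨T, hTS, hT⟩ := Finset.exists_subset_card_eq hle
  refine h T ⟨fun v hv w hw hvw => ?_, hT⟩
  exact hS.isClique (Finset.mem_eraseNone.1 (hTS hv)) (Finset.mem_eraseNone.1 (hTS hw))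
    (fun e => hvw (Option.some_injective _ e))

theorem cone_vArrow {V : Type*} {G : SimpleGraph V} {a : List ℕ} (hne : a ≠ [])
    (h : VArrow G a) : VArrow (cone G) (2 :: a) := by
  classical
  intro (c : Option V → Fin (a.length + 1))
  by_cases hedge : ∃ x y, (cone G).Adj x y ∧ c x = 0 ∧ c y = 0
  · obtain ⟨x, y, hadj, hx, hy⟩ := hedge
    refine ⟨(0 : Fin (a.length + 1)), {x, y}, ⟨?_, Finset.card_pair hadj.ne⟩, ?_⟩
    · rw [Finset.coe_pair, SimpleGraph.isClique_pair]
      exact fun _ => hadj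
    · simp only [Finset.mem_insert, Finset.mem_singleton]
      rintro v (rfl | rfl) <;> assumption
  · push Not at hedge
    have : NeZero a.length := ⟨by simpa using hne⟩
    let pre (d : Fin a.length) : Fin (a.length + 1) → Fin a.length :=
      Fin.cases d id
    obtain ⟨i, K, hK, hc⟩ := h fun v => pre (pre 0 (c none)) (c (some v))
    have hcol : ∀ v ∈ K, c (some v) ≠ 0 → c (some v) = i.succ := by
      intro v hv h0
      obtain ⟨k, hk⟩ := Fin.exists_succ_eq.2 h0
      have := hc v hv
      rw [← hk] at this ⊢
      exact congrArg Fin.succ this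
    by_cases hzero : ∃ u ∈ K, c (some u) = 0
    · obtain ⟨u, hu, hu0⟩ := hzero
      have hnone : c none = i.succ := by
        obtain ⟨k, hk⟩ := Fin.exists_succ_eq.2 fun h0 => hedge none (some u) trivial h0 hu0
        have := hc u hu
        simp only [hu0] at this
        rw [← hk] at this ⊢
        exact congrArg Fin.succ this
      refine ⟨i.succ, insert none ((K.erase u).map .some), ⟨?_, ?_⟩, ?_⟩
      · rw [Finset.coe_insert, SimpleGraph.isClique_insert]
        refine ⟨isClique_cone_map_some (hK.isClique.subset (by simp)), fun x hx _ => ?_⟩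
        obtain ⟨v, -, rfl⟩ := Finset.mem_map.1 hx
        trivial
      · rw [Finset.card_insert_of_notMem (by simp), Finset.card_map,
          Finset.card_erase_add_one hu]
        exact hK.card_eq
      · intro x hx
        obtain rfl | hx := Finset.mem_insert.1 hx
        · exact hnone
        · obtain ⟨v, hv, rfl⟩ := Finset.mem_map.1 hx
          obtain ⟨hvu, hvK⟩ := Finset.mem_erase.1 hv
          exact hcol v hvK fun h0 =>
            hedge (some u) (some v) (hK.isClique hu hvK hvu.symm) hu0 h0
    · push Not at hzero
      refine ⟨i.succ, K.map .some, ⟨isClique_cone_map_some hK.isClique, ?_⟩, ?_⟩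
      · rw [Finset.card_map]
        exact hK.card_eq
      · intro x hx
        obtain ⟨v, hv, rfl⟩ := Finset.mem_map.1 hx
        exact hcol v hv (hzero v hv)

theorem exists_cliqueFree_vArrow_cons_twos {a : List ℕ} (hne : a ≠ []) {q n : ℕ}
    (h : ∃ G : SimpleGraph (Fin n), G.CliqueFree q ∧ VArrow G a) (t : ℕ) :
    ∃ G : SimpleGraph (Fin (n + t)), G.CliqueFree (q + t) ∧
      VArrow G (List.replicate t 2 ++ a) := by
  induction t with
  | zero => simpa using h
  | succ t ih =>
    obtain ⟨G, hfree, harrow⟩ := ih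
    exact exists_fin_familyVArrow (by simp [add_assoc]) (cone_cliqueFree hfree)
      (cone_vArrow (by simp [hne]) harrow)

/-- `F_v(2_t, a₁, …, aₛ; q + t) ≤ F_v(a₁, …, aₛ; q) + t`. -/
theorem folkman_cons_twos_le (a : List ℕ) (hne : a ≠ []) (hpos : ∀ x ∈ a, 0 < x)
    (q : ℕ) (hq : ∀ x ∈ a, x < q) (t : ℕ) (ht : 1 ≤ t) :
    folkman (List.replicate t 2 ++ a) (q + t) ≤ folkman a q + t := by
  have : NeZero a.length := ⟨by simpa using hne⟩
  exact Nat.sInf_le (exists_cliqueFree_vArrow_cons_twos hne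
    (Nat.sInf_mem (exists_cliqueFree_familyVArrow a.get fun i => hq _ (a.get_mem i))) t)
end

section
/- Let p ≥ 3 be an integer and suppose that F_v(2, 2, p; p + 1) ≤ 2p + 5. Then for every integer r ≥ 2, F_v(2_r, p; r + p − 1) = F_v(2, 2, p; p + 1) + r − 2; in particular, the minimum over r ≥ 2 of F_v(2_r, p; r + p − 1) − r is attained at r = 2. -/
namespace VertexFolkman

section

variable {V : Type*} {H : SimpleGraph V}

/-- `U` is covered by `k` cliques of `H`. -/
def CliqueCovered (H : SimpleGraph V) (k : ℕ) (U : Finset V) : Prop :=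
  ∃ f : V → ℕ, (∀ v ∈ U, f v < k) ∧ ∀ u ∈ U, ∀ v ∈ U, u ≠ v → f u = f v → H.Adj u v

theorem cliqueCovered_singleton (v : V) : CliqueCovered H 1 {v} :=
  ⟨fun _ => 0, by simp, by simp +contextual⟩

/-- `c` runs periodically around a cycle of length `L` in `H`. -/
structure IsCyc (H : SimpleGraph V) (L : ℕ) (c : ℤ → V) : Prop where
  eq_iff : ∀ i j, c i = c j ↔ (L : ℤ) ∣ j - i
  adj : ∀ i, H.Adj (c i) (c (i + 1))

namespace IsCyc

variable {L : ℕ} {c : ℤ → V}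

theorem periodic (h : IsCyc H L c) (i : ℤ) : c (i + L) = c i := ((h.eq_iff _ _).2 ⟨-1, by ring⟩)

theorem eq_of_lt (h : IsCyc H L c) {i j : ℤ} (hij : c i = c j) (h1 : i < j + L) (h2 : j < i + L) :
    i = j := by
  obtain ⟨q, hq⟩ := (h.eq_iff i j).1 hij
  have : q < 1 := by nlinarith
  have : -1 < q := by nlinarith
  obtain rfl : q = 0 := by omega
  omega

theorem exists_rep (h : IsCyc H L c) (hL : 0 < L) (a i : ℤ) :
    ∃ j, a ≤ j ∧ j < a + L ∧ c i = c j := by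
  have h1 := Int.emod_nonneg (i - a) (b := (L : ℤ)) (by omega)
  have h2 := Int.emod_lt_of_pos (i - a) (b := (L : ℤ)) (by omega)
  refine ⟨a + (i - a) % L, by omega, by omega, (h.eq_iff _ _).2 ?_⟩
  have := Int.emod_add_mul_ediv (i - a) L
  exact ⟨-((i - a) / L), by linarith⟩

end IsCyc

variable [DecidableEq V]

/-- `U` has a perfect matching with `k` edges in `H`. -/
inductive IsMatched (H : SimpleGraph V) : ℕ → Finset V → Prop
  | empty : IsMatched H 0 ∅
  | insert {k : ℕ} {U : Finset V} {a b : V} (hab : H.Adj a b) (ha : a ∉ U) (hb : b ∉ U)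
      (h : IsMatched H k U) : IsMatched H (k + 1) (insert a (insert b U))

/-- Every independent set of `H` has at most `k` vertices in `U`. -/
def IndepLE (H : SimpleGraph V) (U : Finset V) (k : ℕ) : Prop :=
  ∀ I : Finset V, H.IsIndepSet (I : Set V) → (I ∩ U).card ≤ k

theorem IndepLE.union {U W : Finset V} {j k : ℕ} (hU : IndepLE H U j) (hW : IndepLE H W k) :
    IndepLE H (U ∪ W) (j + k) := by
  intro I hI
  rw [Finset.inter_union_distrib_left]
  exact (Finset.card_union_le _ _).trans (add_le_add (hU I hI) (hW I hI))

theorem IndepLE.mono {U W : Finset V} {j k : ℕ} (h : IndepLE H U j) (hW : W ⊆ U) (hjk : j ≤ k) :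
    IndepLE H W k := fun I hI =>
  (Finset.card_le_card (Finset.inter_subset_inter_left hW)).trans ((h I hI).trans hjk)

theorem indepLE_empty : IndepLE H ∅ 0 := fun I _ => by simp

theorem CliqueCovered.union {U W : Finset V} {j k : ℕ} (hU : CliqueCovered H j U)
    (hW : CliqueCovered H k W) : CliqueCovered H (j + k) (U ∪ W) := by
  obtain ⟨f, hf, hf'⟩ := hU
  obtain ⟨g, hg, hg'⟩ := hW
  refine ⟨fun v => if v ∈ U then f v else j + g v, ?_, ?_⟩
  · intro v hv
    by_cases h : v ∈ U
    · have := hf v h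
      simp only [h, if_true]
      omega
    · have := hg v (by simpa [h] using hv)
      simp only [h, if_false]
      omega
  · intro u hu v hv huv h
    by_cases h1 : u ∈ U <;> by_cases h2 : v ∈ U <;> simp only [h1, h2, if_true, if_false] at h
    · exact hf' u h1 v h2 huv h
    · have := hf u h1
      omega
    · have := hf v h2
      omega
    · exact hg' u (by simpa [h1] using hu) v (by simpa [h2] using hv) huv (by omega)

namespace IsMatched

theorem card {k : ℕ} {U : Finset V} (h : IsMatched H k U) : U.card = 2 * k := by
  induction h with
  | empty => simp
  | insert hab ha hb h ih =>
    rw [Finset.card_insert_of_notMem (by simp [ha, hab.ne]), Finset.card_insert_of_notMem hb, ih]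
    omega

theorem pair {a b : V} (h : H.Adj a b) : IsMatched H 1 {a, b} := by
  simpa using IsMatched.insert h (Finset.notMem_empty a) (Finset.notMem_empty b) .empty

theorem union {j k : ℕ} {U W : Finset V} (hU : IsMatched H j U) (hW : IsMatched H k W)
    (hd : Disjoint U W) : IsMatched H (j + k) (U ∪ W) := by
  induction hU with
  | empty => simpa using hW
  | @insert j U a b hab ha hb h ih =>
    simp only [Finset.disjoint_insert_left] at hd
    have := (ih hd.2.2).insert hab (by simp [ha, hd.1]) (by simp [hb, hd.2.1])
    rw [Finset.insert_union, Finset.insert_union]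
    convert this using 1
    omega

theorem indepLE {k : ℕ} {U : Finset V} (h : IsMatched H k U) : IndepLE H U k := by
  induction h with
  | empty => exact indepLE_empty
  | @insert k U a b hab ha hb h ih =>
    have hp : IndepLE H {a, b} 1 := by
      intro I hI
      rw [Finset.card_le_one]
      intro u hu v hv
      simp only [Finset.mem_inter, Finset.mem_insert, Finset.mem_singleton] at hu hv
      by_contra huv
      refine hI (Finset.mem_coe.2 hu.1) (Finset.mem_coe.2 hv.1) huv ?_
      rcases hu.2 with rfl | rfl <;> rcases hv.2 with rfl | rfl
      · exact absurd rfl huv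
      · exact hab
      · exact hab.symm
      · exact absurd rfl huv
    exact (ih.union hp).mono (by intro x; simp) le_rfl

theorem cliqueCovered {k : ℕ} {U : Finset V} (h : IsMatched H k U) : CliqueCovered H k U := by
  induction h with
  | empty => exact ⟨fun _ => 0, by simp, by simp⟩
  | @insert k U a b hab ha hb h ih =>
    have hp : CliqueCovered H 1 {a, b} := by
      refine ⟨fun _ => 0, by simp, ?_⟩
      intro u hu v hv huv _
      simp only [Finset.mem_insert, Finset.mem_singleton] at hu hv
      rcases hu with rfl | rfl <;> rcases hv with rfl | rfl
      · exact absurd rfl huv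
      · exact hab
      · exact hab.symm
      · exact absurd rfl huv
    have := ih.union hp
    rwa [show U ∪ {a, b} = Insert.insert a (Insert.insert b U) by ext x; simp] at this

theorem split {j k : ℕ} {U : Finset V} (h : IsMatched H (j + k) U) :
    ∃ U₁ U₂, IsMatched H j U₁ ∧ IsMatched H k U₂ ∧ U₁ ∪ U₂ = U := by
  induction j generalizing U with
  | zero => exact ⟨∅, U, .empty, by simpa using h, by simp⟩
  | succ j ih =>
    rw [show j + 1 + k = (j + k) + 1 by omega] at h
    cases h with
    | @insert _ U a b hab ha hb h =>
      obtain ⟨U₁, U₂, h₁, h₂, rfl⟩ := ih h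
      simp only [Finset.mem_union, not_or] at ha hb
      exact ⟨_, _, h₁.insert hab ha.1 hb.1, h₂, by simp [Finset.insert_union]⟩

end IsMatched

/-- The `k` consecutive vertices of `c` that start at position `a`. -/
def arc (c : ℤ → V) (a : ℤ) (k : ℕ) : Finset V := (Finset.range k).image fun t : ℕ => c (a + t)

theorem mem_arc {c : ℤ → V} {a : ℤ} {k : ℕ} {v : V} :
    v ∈ arc c a k ↔ ∃ i, a ≤ i ∧ i < a + k ∧ c i = v := by
  simp only [arc, Finset.mem_image, Finset.mem_range]
  constructor
  · rintro ⟨t, ht, rfl⟩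
    exact ⟨a + t, by omega, by omega, rfl⟩
  · rintro ⟨i, h1, h2, rfl⟩
    exact ⟨(i - a).toNat, by omega, by congr 1; omega⟩

theorem arc_add (c : ℤ → V) (a : ℤ) (j k : ℕ) : arc c a (j + k) = arc c a j ∪ arc c (a + j) k := by
  ext v
  simp only [Finset.mem_union, mem_arc]
  constructor
  · rintro ⟨i, h1, h2, h3⟩
    by_cases h : i < a + j
    · exact Or.inl ⟨i, h1, h, h3⟩
    · exact Or.inr ⟨i, by omega, by push_cast at h2; omega, h3⟩
  · rintro (⟨i, h1, h2, h3⟩ | ⟨i, h1, h2, h3⟩) <;> exact ⟨i, by omega, by push_cast; omega, h3⟩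

namespace IsCyc

variable {L : ℕ} {c : ℤ → V}

theorem mem_arc_full (h : IsCyc H L c) (hL : 0 < L) {a : ℤ} {v : V} :
    v ∈ arc c a L ↔ ∃ i, c i = v := by
  rw [mem_arc]
  constructor
  · rintro ⟨i, -, -, hi⟩
    exact ⟨i, hi⟩
  · rintro ⟨i, rfl⟩
    obtain ⟨j, h1, h2, h3⟩ := h.exists_rep hL a i
    exact ⟨j, h1, h2, h3.symm⟩

theorem arc_full (h : IsCyc H L c) (hL : 0 < L) (a b : ℤ) : arc c a L = arc c b L := by
  ext v
  rw [h.mem_arc_full hL, h.mem_arc_full hL]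

theorem disjoint_arc (h : IsCyc H L c) {a b : ℤ} {j k : ℕ} (hab : a + j ≤ b) (hb : b + k ≤ a + L) :
    Disjoint (arc c a j) (arc c b k) := by
  rw [Finset.disjoint_left]
  intro v hv hw
  obtain ⟨i, h1, h2, rfl⟩ := mem_arc.1 hv
  obtain ⟨i', h3, h4, h5⟩ := mem_arc.1 hw
  have := h.eq_of_lt h5 (by omega) (by omega)
  omega

theorem card_arc (h : IsCyc H L c) {a : ℤ} {k : ℕ} (hk : k ≤ L) : (arc c a k).card = k := by
  rw [arc, Finset.card_image_of_injOn, Finset.card_range]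
  intro i hi j hj hij
  simp only [Finset.coe_range, Set.mem_Iio] at hi hj
  have := h.eq_of_lt hij (by omega) (by omega)
  omega

theorem isMatched_arc (h : IsCyc H L c) (a : ℤ) {k : ℕ} (hk : 2 * k ≤ L) :
    IsMatched H k (arc c a (2 * k)) := by
  induction k with
  | zero => exact .empty
  | succ k ih =>
    rw [show 2 * (k + 1) = 2 * k + 2 by ring, arc_add]
    refine (ih (by omega)).union ?_ (h.disjoint_arc (by omega) (by push_cast; omega))
    convert IsMatched.pair (h.adj (a + (2 * k : ℕ))) using 1
    ext v
    simp [arc, Finset.range_add_one]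
    tauto

theorem indepLE {l : ℕ} (h : IsCyc H (2 * l + 1) c) (a : ℤ) :
    IndepLE H (arc c a (2 * l + 1)) l := by
  intro I hI
  have hc : ∃ i, c i ∉ I := by
    by_contra! hall
    exact hI (hall 0) (hall (0 + 1)) (h.adj 0).ne (h.adj 0)
  obtain ⟨i, hi⟩ := hc
  rw [h.arc_full (by omega) a (i + 1), arc_add]
  refine le_trans (Finset.card_le_card ?_) ((h.isMatched_arc (i + 1) (k := l) (by omega)).indepLE I hI)
  intro v hv
  simp only [Finset.mem_inter, Finset.mem_union] at hv ⊢
  refine ⟨hv.1, hv.2.resolve_right fun hv' => hi ?_⟩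
  obtain ⟨j, h1, h2, rfl⟩ := mem_arc.1 hv'
  convert hv.1 using 1
  rw [← h.periodic i]
  congr 1
  push_cast at *
  omega

theorem of_path {p : ℕ → V} (hL : 0 < L) (hinj : ∀ i < L, ∀ j < L, p i = p j → i = j)
    (hadj : ∀ i, i + 1 < L → H.Adj (p i) (p (i + 1))) (hclose : H.Adj (p (L - 1)) (p 0)) :
    IsCyc H L (fun i => p (i % L).toNat) ∧
      arc (fun i : ℤ => p (i % L).toNat) 0 L = (Finset.range L).image p := by
  have hb : ∀ i : ℤ, 0 ≤ i % (L : ℤ) ∧ i % (L : ℤ) < L := fun i =>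
    ⟨Int.emod_nonneg _ (by omega), Int.emod_lt_of_pos _ (by omega)⟩
  refine ⟨⟨fun i j => ?_, fun i => ?_⟩, ?_⟩
  · have h1 := hb i
    have h2 := hb j
    rw [← Int.modEq_iff_dvd]
    constructor
    · intro h
      have := hinj _ (by omega) _ (by omega) h
      change i % L = j % L
      omega
    · intro h
      change i % L = j % L at h
      simp only [h]
  · have h1 := hb i
    rcases eq_or_lt_of_le (show i % (L : ℤ) + 1 ≤ L by omega) with h | h
    · have : (i + 1) % (L : ℤ) = 0 := by
        rw [← Int.emod_add_emod, h, Int.emod_self]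
      simp only [this, Int.toNat_zero]
      convert hclose using 2
      omega
    · have : (i + 1) % (L : ℤ) = i % L + 1 := by
        rw [← Int.emod_add_emod, Int.emod_eq_of_lt (by omega) h]
      simp only [this]
      convert hadj (i % L).toNat (by omega) using 2
      omega
  · ext v
    simp only [arc, Finset.mem_image, Finset.mem_range, zero_add]
    refine exists_congr fun t => and_congr_right fun ht => ?_
    rw [Int.emod_eq_of_lt (by omega) (by omega)]
    simp

end IsCyc

end

section

variable {V : Type*} {H : SimpleGraph V}

/-- Some three positions of the cycle `c` of length `2 * l + 1` that split it into three paths with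
an odd number of edges carry vertices satisfying `A`. -/
def OddTriple (l : ℕ) (c : ℤ → V) (A : V → Prop) : Prop :=
  ∃ (a : ℤ) (m₁ m₂ m₃ : ℕ), m₁ + m₂ + m₃ + 1 = l ∧ A (c a) ∧ A (c (a + 2 * m₁ + 1)) ∧
    A (c (a + 2 * m₁ + 2 * m₂ + 2))

theorem OddTriple.imp {l : ℕ} {c : ℤ → V} {A B : V → Prop} (h : OddTriple l c A)
    (hAB : ∀ i, A (c i) → B (c i)) : OddTriple l c B := by
  obtain ⟨a, m₁, m₂, m₃, hm, h1, h2, h3⟩ := h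
  exact ⟨a, m₁, m₂, m₃, hm, hAB _ h1, hAB _ h2, hAB _ h3⟩

variable [DecidableEq V]

theorem IsCyc.mem_arc_iff {L : ℕ} {c : ℤ → V} (h : IsCyc H L c) {a b i : ℤ} {k : ℕ} (hab : a ≤ b)
    (hb : b + k ≤ a + L) (hi : a ≤ i) (hi' : i < a + L) :
    c i ∈ arc c b k ↔ b ≤ i ∧ i < b + k := by
  rw [mem_arc]
  constructor
  · rintro ⟨j, h1, h2, h3⟩
    obtain rfl := h.eq_of_lt h3 (by omega) (by omega)
    exact ⟨h1, h2⟩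
  · rintro ⟨h1, h2⟩
    exact ⟨i, h1, h2, rfl⟩

variable [Fintype V]

/-- `c` is an odd cycle, of length `2 * l + 1`, whose complement has a perfect matching, and it is
a shortest such cycle. -/
structure IsShortest (H : SimpleGraph V) (l : ℕ) (c : ℤ → V) : Prop where
  cyc : IsCyc H (2 * l + 1) c
  rest : ∃ k, IsMatched H k (Finset.univ \ arc c 0 (2 * l + 1))
  min : ∀ (l' : ℕ) (c' : ℤ → V), IsCyc H (2 * l' + 1) c' →
    (∃ k, IsMatched H k (Finset.univ \ arc c' 0 (2 * l' + 1))) → l ≤ l'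

namespace IsShortest

variable {l : ℕ} {c : ℤ → V}

theorem mem_iff (h : IsShortest H l c) {v : V} : v ∈ arc c 0 (2 * l + 1) ↔ ∃ i, c i = v :=
  h.cyc.mem_arc_full (by omega)

theorem rep (h : IsShortest H l c) (a i : ℤ) : ∃ j, a ≤ j ∧ j < a + (2 * l + 1) ∧ c i = c j := by
  simpa using h.cyc.exists_rep (by omega) a i

theorem periodic (h : IsShortest H l c) (i : ℤ) : c (i + (2 * l + 1)) = c i := by
  simpa using h.cyc.periodic i

theorem le_of_arc (h : IsShortest H l c) (a : ℤ) {m s l' k : ℕ} {q : ℕ → V} {R : Finset V}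
    (hm : m ≤ 2 * l) (hs : m + 1 + s = 2 * l' + 1) (hq : ∀ i < s, ∀ j, c j ≠ q i)
    (hinj : ∀ i < s, ∀ j < s, q i = q j → i = j)
    (hadj : ∀ i, i + 1 < s → H.Adj (q i) (q (i + 1)))
    (hfirst : 0 < s → H.Adj (c (a + m)) (q 0))
    (hlast : 0 < s → H.Adj (q (s - 1)) (c a)) (hzero : s = 0 → H.Adj (c (a + m)) (c a))
    (hR : IsMatched H k R) (hRq : ∀ i < s, q i ∉ R) (hRa : Disjoint R (arc c a (m + 1)))
    (hcover : ∀ v, v ∈ R ∨ v ∈ arc c a (m + 1) ∨ ∃ i < s, q i = v) : l ≤ l' := by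
  set p : ℕ → V := fun t => if t < m + 1 then c (a + t) else q (t - (m + 1)) with hp
  have key := IsCyc.of_path (H := H) (L := 2 * l' + 1) (p := p) (by omega) ?_ ?_ ?_
  · refine h.min _ _ key.1 ⟨k, ?_⟩
    rw [key.2]
    convert hR using 1
    ext v
    simp only [Finset.mem_sdiff, Finset.mem_univ, true_and, Finset.mem_image, Finset.mem_range]
    constructor
    · intro hv
      rcases hcover v with h1 | h1 | ⟨i, hi, rfl⟩
      · exact h1
      · obtain ⟨j, h2, h3, rfl⟩ := mem_arc.1 h1
        refine absurd ⟨(j - a).toNat, by omega, ?_⟩ hv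
        simp only [hp]
        rw [if_pos (by omega)]
        congr 1
        omega
      · refine absurd ⟨m + 1 + i, by omega, ?_⟩ hv
        simp only [hp]
        rw [if_neg (by omega), Nat.add_sub_cancel_left]
    · rintro hv ⟨t, ht, rfl⟩
      simp only [hp] at hv
      split_ifs at hv with h1
      · exact Finset.disjoint_left.1 hRa hv (mem_arc.2 ⟨a + t, by omega, by push_cast; omega, rfl⟩)
      · exact hRq _ (by omega) hv
  · intro i hi j hj hij
    simp only [hp] at hij
    split_ifs at hij with h1 h2 h2
    · have := h.cyc.eq_of_lt hij (by push_cast; omega) (by push_cast; omega)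
      omega
    · exact absurd hij (hq _ (by omega) _)
    · exact absurd hij.symm (hq _ (by omega) _)
    · have := hinj _ (by omega) _ (by omega) hij
      omega
  · intro i hi
    simp only [hp]
    rcases lt_trichotomy i m with h1 | rfl | h1
    · rw [if_pos (by omega), if_pos (by omega)]
      push_cast
      rw [← add_assoc]
      exact h.cyc.adj _
    · rw [if_pos (by omega), if_neg (by omega), Nat.sub_self]
      exact hfirst (by omega)
    · rw [if_neg (by omega), if_neg (by omega), Nat.sub_add_comm (by omega)]
      exact hadj _ (by omega)
  · simp only [hp]
    rw [if_pos (Nat.succ_pos m)]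
    simp only [Nat.cast_zero, add_zero]
    rcases Nat.eq_zero_or_pos s with h0 | h0
    · rw [if_pos (by omega)]
      convert hzero h0 using 3
      omega
    · rw [if_neg (by omega)]
      convert hlast h0 using 2
      omega

theorem not_adj_even (h : IsShortest H l c) (a : ℤ) {e : ℕ} (he : e + 1 ≤ l)
    (hadj : H.Adj (c a) (c (a + 2 * e))) : False := by
  obtain ⟨k, hk⟩ := h.rest
  have hL := h.cyc.isMatched_arc (a + 2 * e + 1) (k := l - e) (by omega)
  have hf : arc c 0 (2 * l + 1) = arc c a (2 * l + 1) := h.cyc.arc_full (by omega) _ _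
  rw [hf] at hk
  have hwin := fun (b i : ℤ) (k : ℕ) => h.cyc.mem_arc_iff (a := a) (b := b) (i := i) (k := k)
  push_cast at hwin
  have hmem : ∀ v, v ∈ arc c a (2 * l + 1) → ∃ i, a ≤ i ∧ i < a + (2 * l + 1) ∧ c i = v := by
    intro v hv
    simpa using mem_arc.1 hv
  have hd : Disjoint (Finset.univ \ arc c a (2 * l + 1)) (arc c (a + 2 * e + 1) (2 * (l - e))) := by
    rw [Finset.disjoint_left]
    intro v hv hv'
    obtain ⟨i, h1, h2, rfl⟩ := mem_arc.1 hv'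
    simp only [Finset.mem_sdiff, Finset.mem_univ, true_and] at hv
    exact hv (mem_arc.2 ⟨i, by omega, by push_cast; omega, rfl⟩)
  have := h.le_of_arc a (m := 2 * e) (s := 0) (l' := e) (q := fun _ => c 0) (by omega) (by omega)
    (by simp) (by simp) (by simp) (by simp) (by simp) (fun _ => by push_cast; exact hadj.symm)
    (hk.union hL hd) (by simp) ?_ ?_
  · omega
  · rw [Finset.disjoint_left]
    intro v hv hv'
    obtain ⟨i, h1, h2, rfl⟩ := mem_arc.1 hv'
    push_cast at h2
    rw [Finset.mem_union, Finset.mem_sdiff, hwin _ _ _ (by omega) (by omega) (by omega) (by omega),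
      hwin _ _ _ (by omega) (by push_cast; omega) (by omega) (by omega)] at hv
    omega
  · intro v
    by_cases hv : v ∈ arc c a (2 * l + 1)
    · obtain ⟨i, h1, h2, rfl⟩ := hmem v hv
      rw [Finset.mem_union, hwin _ _ (2 * (l - e)) (by omega) (by omega) (by omega) (by omega),
        hwin _ _ (2 * e + 1) (by omega) (by omega) (by omega) (by omega)]
      omega
    · exact Or.inl (Finset.mem_union_left _ (by simp [hv]))

theorem notMem_iff (h : IsShortest H l c) {v : V} :
    v ∉ arc c 0 (2 * l + 1) ↔ ∀ i, c i ≠ v := by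
  rw [h.mem_iff]
  push Not
  rfl

/-- Deleting `c` and the two vertices `u` and `v` leaves a graph with a perfect matching. -/
def RestMatched (H : SimpleGraph V) (l : ℕ) (c : ℤ → V) (u v : V) : Prop :=
  ∃ k, IsMatched H k ((Finset.univ \ arc c 0 (2 * l + 1)) \ {u, v})

theorem RestMatched.symm {u v : V} (h : RestMatched H l c u v) : RestMatched H l c v u := by
  rwa [RestMatched, Finset.pair_comm]

theorem le_of_edge (h : IsShortest H l c) {u v : V} (hu : ∀ i, c i ≠ u) (hv : ∀ i, c i ≠ v)
    (hX : RestMatched H l c u v) (huv : H.Adj u v) {a : ℤ} {e : ℕ} (he : e ≤ l)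
    (hua : H.Adj u (c a)) (hva : H.Adj v (c (a + 2 * e))) : l ≤ e + 1 := by
  obtain ⟨k, hk⟩ := hX
  have hL := h.cyc.isMatched_arc (a + 2 * e + 1) (k := l - e) (by omega)
  have hf : arc c 0 (2 * l + 1) = arc c a (2 * l + 1) := h.cyc.arc_full (by omega) _ _
  have hall : ∀ x, x ∈ arc c a (2 * l + 1) ∨ ∀ i, c i ≠ x := by
    intro x
    rw [← hf, ← h.notMem_iff]
    exact em _
  have hin : ∀ i, c i ∈ arc c a (2 * l + 1) := fun i => by
    rw [← hf, h.mem_iff]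
    exact ⟨i, rfl⟩
  have hout : ∀ x, (∀ i, c i ≠ x) → ∀ b j, x ∉ arc c b j := fun x hx b j hxb => by
    obtain ⟨i, -, -, rfl⟩ := mem_arc.1 hxb
    exact hx i rfl
  rw [hf] at hk
  have hwin := fun (b i : ℤ) (k : ℕ) => h.cyc.mem_arc_iff (a := a) (b := b) (i := i) (k := k)
  push_cast at hwin
  have hd : Disjoint ((Finset.univ \ arc c a (2 * l + 1)) \ {u, v})
      (arc c (a + 2 * e + 1) (2 * (l - e))) := by
    rw [Finset.disjoint_left]
    intro x hx hx'
    obtain ⟨i, h1, h2, rfl⟩ := mem_arc.1 hx'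
    simp [hin] at hx
  refine h.le_of_arc a (m := 2 * e) (s := 2) (l' := e + 1) (q := fun i => if i = 0 then v else u)
    (by omega) (by omega) ?_ ?_ ?_ ?_ ?_ (by simp) (hk.union hL hd) ?_ ?_ ?_
  · intro i _ j
    split_ifs
    exacts [hv j, hu j]
  · intro i hi j hj hij
    have := huv.ne
    interval_cases i <;> interval_cases j <;> simp_all
  · intro i hi
    obtain rfl : i = 0 := by omega
    simpa using huv.symm
  · intro _
    push_cast
    simpa using hva.symm
  · intro _
    simpa using hua
  · intro i hi
    interval_cases i <;> simp [hout _ hu, hout _ hv]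
  · rw [Finset.disjoint_union_left]
    constructor
    · rw [Finset.disjoint_left]
      intro x hx hx'
      obtain ⟨i, h1, h2, rfl⟩ := mem_arc.1 hx'
      simp [hin] at hx
    · exact (h.cyc.disjoint_arc (by push_cast; omega) (by push_cast; omega)).symm
  · intro x
    rcases hall x with hx | hx
    · obtain ⟨i, h1, h2, rfl⟩ := mem_arc.1 hx
      push_cast at h2
      rw [Finset.mem_union, hwin _ _ (2 * (l - e)) (by omega) (by omega) (by omega) (by omega),
        hwin _ _ (2 * e + 1) (by omega) (by omega) (by omega) (by omega)]
      omega
    · by_cases hxv : x = v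
      · exact Or.inr (Or.inr ⟨0, by simp [hxv]⟩)
      by_cases hxu : x = u
      · exact Or.inr (Or.inr ⟨1, by simp [hxu]⟩)
      · exact Or.inl (Finset.mem_union_left _ (by simp [hxu, hxv, hout _ hx]))

theorem eq_of_three (h : IsShortest H l c) {u v : V} (hu : ∀ i, c i ≠ u) (hv : ∀ i, c i ≠ v)
    (hX : RestMatched H l c u v) (huv : u ≠ v) {a : ℤ} {m m' : ℕ} (hm : m + m' < l)
    (hua : H.Adj u (c a)) (hub : H.Adj u (c (a + 2 * m + 1)))
    (hvb : H.Adj v (c (a + 2 * m + 2 * m' + 2))) : m + 1 = l := by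
  obtain ⟨k, hk⟩ := hX
  have hf : arc c 0 (2 * l + 1) = arc c a (2 * l + 1) := h.cyc.arc_full (by omega) _ _
  have hall : ∀ x, x ∈ arc c a (2 * l + 1) ∨ ∀ i, c i ≠ x := by
    intro x
    rw [← hf, ← h.notMem_iff]
    exact em _
  have hin : ∀ i, c i ∈ arc c a (2 * l + 1) := fun i => by
    rw [← hf, h.mem_iff]
    exact ⟨i, rfl⟩
  have hout : ∀ x, (∀ i, c i ≠ x) → ∀ b j, x ∉ arc c b j := fun x hx b j hxb => by
    obtain ⟨i, -, -, rfl⟩ := mem_arc.1 hxb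
    exact hx i rfl
  rw [hf] at hk
  have hwin := fun (b i : ℤ) (k : ℕ) => h.cyc.mem_arc_iff (a := a) (b := b) (i := i) (k := k)
  push_cast at hwin
  have h1 := h.cyc.isMatched_arc (a + 2 * m + 2) (k := m') (by omega)
  have h2 := h.cyc.isMatched_arc (a + 2 * m + 2 * m' + 3) (k := l - m - m' - 1) (by omega)
  have h3 := IsMatched.pair hvb
  have h12 := h1.union h2 (h.cyc.disjoint_arc (by push_cast; omega) (by push_cast; omega))
  have h123 := h12.union h3 (by
    rw [Finset.disjoint_insert_right, Finset.disjoint_singleton_right]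
    refine ⟨by simp [hout _ hv], ?_⟩
    rw [Finset.mem_union, hwin _ _ (2 * m') (by omega) (by omega) (by omega) (by omega),
        hwin _ _ (2 * (l - m - m' - 1)) (by omega) (by omega) (by omega) (by omega)]
    omega)
  have hall4 := hk.union h123 (by
    rw [Finset.disjoint_left]
    intro x hx hx'
    simp only [Finset.mem_union, Finset.mem_insert, Finset.mem_singleton] at hx'
    rcases hx' with (hx' | hx') | rfl | rfl
    · obtain ⟨i, -, -, rfl⟩ := mem_arc.1 hx'
      simp [hin] at hx
    · obtain ⟨i, -, -, rfl⟩ := mem_arc.1 hx'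
      simp [hin] at hx
    · simp at hx
    · simp [hin] at hx)
  suffices l ≤ m + 1 by omega
  refine h.le_of_arc a (m := 2 * m + 1) (s := 1) (l' := m + 1) (q := fun _ => u)
    (by omega) (by omega) (fun _ _ j => hu j) (by omega) (by omega) ?_ (fun _ => hua) (by omega)
    hall4 ?_ ?_ ?_
  · intro _
    push_cast
    rw [← add_assoc]
    exact hub.symm
  · intro _ _
    simp [hout _ hu, huv, (hu _).symm]
  · rw [Finset.disjoint_left]
    intro x hx hx'
    obtain ⟨i, g1, g2, rfl⟩ := mem_arc.1 hx'
    push_cast at g2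
    simp only [Finset.mem_union, Finset.mem_insert, Finset.mem_singleton] at hx
    rw [hwin _ _ (2 * m') (by omega) (by omega) (by omega) (by omega),
      hwin _ _ (2 * (l - m - m' - 1)) (by omega) (by omega) (by omega) (by omega)] at hx
    rcases hx with hx | (hx | hx) | hx | hx
    · simp [hin] at hx
    · omega
    · omega
    · exact hv _ hx
    · have := h.cyc.eq_of_lt hx (by push_cast; omega) (by push_cast; omega)
      omega
  · intro x
    rcases hall x with hx | hx
    · obtain ⟨i, g1, g2, rfl⟩ := mem_arc.1 hx
      push_cast at g2
      simp only [Finset.mem_union, Finset.mem_insert, Finset.mem_singleton]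
      rw [hwin _ _ (2 * m') (by omega) (by omega) (by omega) (by omega),
        hwin _ _ (2 * (l - m - m' - 1)) (by omega) (by omega) (by omega) (by omega),
        hwin _ _ (2 * m + 1 + 1) (by omega) (by omega) (by omega) (by omega)]
      by_cases hi : i = a + 2 * m + 2 * m' + 2
      · simp [hi]
      · omega
    · by_cases hxv : x = v
      · simp [hxv]
      by_cases hxu : x = u
      · exact Or.inr (Or.inr ⟨0, by simp [hxu]⟩)
      · exact Or.inl (Finset.mem_union_left _ (by simp [hxu, hxv, hout _ hx]))

end IsShortest

end

section

variable {V : Type*} {H : SimpleGraph V} [DecidableEq V] [Fintype V]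

namespace IsShortest

variable {l : ℕ} {c : ℤ → V}

theorem exists_indep (h : IsShortest H l c) {A : V → Prop} (hA : ¬OddTriple l c A) :
    ∃ I : Finset V, I ⊆ arc c 0 (2 * l + 1) ∧ H.IsIndepSet (I : Set V) ∧ I.card = l ∧
      ∀ x ∈ I, ¬A x := by
  by_cases hi : ∃ i, ∀ t : ℕ, t < l → ¬A (c (i + 2 * t))
  · obtain ⟨i, hi⟩ := hi
    have hne : ∀ s t : ℕ, s < t → t < l → ¬H.Adj (c (i + 2 * s)) (c (i + 2 * t)) := by
      intro s t hst ht hadj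
      refine h.not_adj_even (i + 2 * s) (e := t - s) (by omega) ?_
      convert hadj using 2
      omega
    refine ⟨(Finset.range l).image fun t : ℕ => c (i + 2 * t), ?_, ?_, ?_, ?_⟩
    · intro v hv
      obtain ⟨t, -, rfl⟩ := Finset.mem_image.1 hv
      exact h.mem_iff.2 ⟨_, rfl⟩
    · intro u hu v hv huv hadj
      simp only [Finset.coe_image, Finset.coe_range, Set.mem_image, Set.mem_Iio] at hu hv
      obtain ⟨s, hs, rfl⟩ := hu
      obtain ⟨t, ht, rfl⟩ := hv
      rcases lt_trichotomy s t with h1 | rfl | h1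
      · exact hne s t h1 ht hadj
      · exact huv rfl
      · exact hne t s h1 hs hadj.symm
    · rw [Finset.card_image_of_injOn, Finset.card_range]
      intro s hs t ht hst
      simp only [Finset.coe_range, Set.mem_Iio] at hs ht
      have := h.cyc.eq_of_lt hst (by push_cast; omega) (by push_cast; omega)
      omega
    · intro x hx
      obtain ⟨t, ht, rfl⟩ := Finset.mem_image.1 hx
      exact hi t (Finset.mem_range.1 ht)
  · push Not at hi
    exfalso
    obtain ⟨t₀, -, h₀⟩ := hi 0
    set a : ℤ := 0 + 2 * t₀
    have hex : ∃ t : ℕ, t < l ∧ A (c (a + 2 + 2 * t)) := hi _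
    classical
    let T := (Finset.range l).filter fun t : ℕ => A (c (a + 2 + 2 * t))
    have hT : T.Nonempty := by
      obtain ⟨t, ht, ht'⟩ := hex
      exact ⟨t, by simp [T, ht, ht']⟩
    have hmem := T.max'_mem hT
    set t₁ := T.max' hT with ht₁
    simp only [T, Finset.mem_filter, Finset.mem_range] at hmem
    obtain ⟨t₂, h2, h2'⟩ := hi (a + 2 + 2 * t₁ + 2)
    have hgt : l ≤ t₁ + 1 + t₂ := by
      by_contra! hlt
      have : t₁ + 1 + t₂ ∈ T := by
        simp only [T, Finset.mem_filter, Finset.mem_range]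
        refine ⟨hlt, ?_⟩
        convert h2' using 2
        push_cast
        ring
      have := T.le_max' _ this
      omega
    refine hA ⟨a, t₁ + 1 + t₂ - l, l - 1 - t₂, l - 1 - t₁, by omega, h₀, ?_, ?_⟩
    · rw [← h.periodic]
      convert h2' using 2
      omega
    · convert hmem.2 using 2
      omega

theorem adj_diff (h : IsShortest H l c) {u v : V} (hu : ∀ i, c i ≠ u) (hv : ∀ i, c i ≠ v)
    (hX : RestMatched H l c u v) (huv : H.Adj u v) {i j : ℤ}
    (hui : H.Adj u (c i)) (hvj : H.Adj v (c j)) (h1 : j - i < 2 * l + 1) (h2 : i - j < 2 * l + 1) :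
    j - i = 1 ∨ j - i = 3 ∨ j - i = 2 * l ∨ j - i = 2 * l - 2 ∨
      i - j = 1 ∨ i - j = 3 ∨ i - j = 2 * l ∨ i - j = 2 * l - 2 := by
  have key := fun (a : ℤ) (e : ℕ) => h.le_of_edge hu hv hX huv (a := a) (e := e)
  have key' := fun (a : ℤ) (e : ℕ) => h.le_of_edge hv hu hX.symm huv.symm (a := a) (e := e)
  have hui' := hui
  have hvj' := hvj
  rw [← h.periodic] at hui' hvj'
  rcases le_total i j with hij | hij <;> rcases Int.even_or_odd' (j - i) with ⟨e, he | he⟩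
  · have := key i e.toNat (by omega) hui (by convert hvj using 2; omega)
    omega
  · have := key' j (l - e).toNat (by omega) hvj (by convert hui' using 2; omega)
    omega
  · have := key' j (-e).toNat (by omega) hvj (by convert hui using 2; omega)
    omega
  · have := key i (l + e + 1).toNat (by omega) hui (by convert hvj' using 2; omega)
    omega

theorem cases_of_oddTriple (h : IsShortest H l c) {u v : V} (hu : ∀ i, c i ≠ u)
    (hv : ∀ i, c i ≠ v) (hX : RestMatched H l c u v) (huv : u ≠ v) {a : ℤ} {m₁ m₂ m₃ : ℕ}
    (hm : m₁ + m₂ + m₃ + 1 = l) (h1 : H.Adj u (c a)) (h2 : H.Adj u (c (a + 2 * m₁ + 1)))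
    (h3 : H.Adj u (c (a + 2 * m₁ + 2 * m₂ + 2))) {j : ℤ} (hj : H.Adj v (c j)) :
    (m₂ + 1 = l ∧ c j = c a) ∨ (m₃ + 1 = l ∧ c j = c (a + 2 * m₁ + 1)) ∨
      (m₁ + 1 = l ∧ c j = c (a + 2 * m₁ + 2 * m₂ + 2)) := by
  have key : ∀ (a : ℤ) (m₁ m₂ m₃ : ℕ), m₁ + m₂ + m₃ + 1 = l → H.Adj u (c a) →
      H.Adj u (c (a + 2 * m₁ + 1)) → H.Adj u (c (a + 2 * m₁ + 2 * m₂ + 2)) → ∀ j, H.Adj v (c j) →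
      a ≤ j → j < a + 2 * m₁ + 1 → m₂ + 1 = l ∧ c j = c a := by
    intro a m₁ m₂ m₃ hm h1 h2 h3 j hj ha hb
    have hj' := hj
    have h1' := h1
    rw [← h.periodic] at hj' h1'
    have k1 := fun m' : ℕ => h.eq_of_three hu hv hX huv (a := a + 2 * m₁ + 1) (m := m₂) (m' := m')
    have k2 := fun m' : ℕ => h.eq_of_three hu hv hX huv (a := a + 2 * m₁ + 2 * m₂ + 2) (m := m₃)
      (m' := m')
    obtain ⟨t, ht | ht⟩ := Int.even_or_odd' (j - a)
    · have := k1 (m₃ + t.toNat) (by omega) h2 (by convert h3 using 2; ring)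
        (by convert hj' using 2; push_cast; omega)
      obtain rfl : j = a := by omega
      exact ⟨this, rfl⟩
    · have := k2 t.toNat (by omega) h3 (by convert h1' using 2; omega)
        (by convert hj' using 2; omega)
      omega
  have h1' := h1
  have h2' := h2
  rw [← h.periodic] at h1' h2'
  obtain ⟨i, hi, hi', hji⟩ := h.rep a j
  rw [hji] at hj ⊢
  rcases lt_or_ge i (a + 2 * m₁ + 1) with hlt | hge
  · exact Or.inl (key a m₁ m₂ m₃ hm h1 h2 h3 i hj hi hlt)
  rcases lt_or_ge i (a + 2 * m₁ + 2 * m₂ + 2) with hlt' | hge'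
  · exact Or.inr (Or.inl (key (a + 2 * m₁ + 1) m₂ m₃ m₁ (by omega) h2 (by convert h3 using 2; ring)
      (by convert h1' using 2; omega) i hj hge (by omega)))
  · exact Or.inr (Or.inr (key (a + 2 * m₁ + 2 * m₂ + 2) m₃ m₁ m₂ (by omega) h3
      (by convert h1' using 2; omega) (by convert h2' using 2; omega)
      i hj hge' (by omega)))

theorem eq_of_oddTriple (h : IsShortest H l c) (hl : 2 ≤ l) {u v : V} (hu : ∀ i, c i ≠ u)
    (hv : ∀ i, c i ≠ v) (hX : RestMatched H l c u v) (huv : u ≠ v)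
    (hA : OddTriple l c (H.Adj u)) {i j : ℤ} (hi : H.Adj v (c i)) (hj : H.Adj v (c j)) :
    c i = c j := by
  obtain ⟨a, m₁, m₂, m₃, hm, h1, h2, h3⟩ := hA
  have k1 := h.cases_of_oddTriple hu hv hX huv hm h1 h2 h3 hi
  have k2 := h.cases_of_oddTriple hu hv hX huv hm h1 h2 h3 hj
  rcases k1 with ⟨e1, f1⟩ | ⟨e1, f1⟩ | ⟨e1, f1⟩ <;> rcases k2 with ⟨e2, f2⟩ | ⟨e2, f2⟩ | ⟨e2, f2⟩ <;>
    first | exact f1.trans f2.symm | omega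

theorem adj_of_oddTriple (h : IsShortest H l c) {u v : V} (hu : ∀ i, c i ≠ u)
    (hv : ∀ i, c i ≠ v) (hX : RestMatched H l c u v) (huv : u ≠ v)
    (hA : OddTriple l c (H.Adj u)) {j : ℤ} (hj : H.Adj v (c j)) : H.Adj u (c j) := by
  obtain ⟨a, m₁, m₂, m₃, hm, h1, h2, h3⟩ := hA
  rcases h.cases_of_oddTriple hu hv hX huv hm h1 h2 h3 hj with ⟨-, f⟩ | ⟨-, f⟩ | ⟨-, f⟩ <;> rwa [f]

theorem not_oddTriple_of_oddTriple (h : IsShortest H l c) (hl : 2 ≤ l) {u v : V}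
    (hu : ∀ i, c i ≠ u) (hv : ∀ i, c i ≠ v) (hX : RestMatched H l c u v) (huv : u ≠ v)
    (hA : OddTriple l c (H.Adj u)) : ¬OddTriple l c (H.Adj v) := by
  rintro ⟨a, m₁, m₂, m₃, hm, h1, h2, -⟩
  have := h.cyc.eq_of_lt (h.eq_of_oddTriple hl hu hv hX huv hA h1 h2) (by push_cast; omega)
    (by push_cast; omega)
  omega

theorem not_oddTriple_of_adj (h : IsShortest H l c) (hl : 2 ≤ l) {u v : V}
    (hu : ∀ i, c i ≠ u) (hv : ∀ i, c i ≠ v) (hX : RestMatched H l c u v) (huv : H.Adj u v)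
    {j : ℤ} (hj : H.Adj v (c j)) : ¬OddTriple l c (H.Adj u) := by
  intro hA
  have := h.le_of_edge hu hv hX huv (e := 0) (by omega)
    (h.adj_of_oddTriple hu hv hX huv.ne hA hj) (by simpa using hj)
  omega

theorem card_inter_lt (h : IsShortest H l c) {u : V} (hA : OddTriple l c (H.Adj u))
    {I : Finset V} (hI : H.IsIndepSet (I : Set V)) (huI : u ∈ I) :
    (I ∩ arc c 0 (2 * l + 1)).card < l := by
  obtain ⟨a, m₁, m₂, m₃, hm, h1, h2, h3⟩ := hA
  have hn : ∀ v, H.Adj u v → v ∉ I := fun v huv hv => hI huI hv huv.ne huv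
  have k1 := h.cyc.isMatched_arc (a + 1) (k := m₁) (by omega)
  have k2 := h.cyc.isMatched_arc (a + 2 * m₁ + 2) (k := m₂) (by omega)
  have k3 := h.cyc.isMatched_arc (a + 2 * m₁ + 2 * m₂ + 3) (k := m₃) (by omega)
  have := ((k1.indepLE.union k2.indepLE).union k3.indepLE) I hI
  refine lt_of_le_of_lt (Finset.card_le_card ?_) (lt_of_le_of_lt this (by omega))
  rw [h.cyc.arc_full (by omega) 0 a]
  intro x hx
  obtain ⟨hxI, hx⟩ := Finset.mem_inter.1 hx
  obtain ⟨i, g1, g2, rfl⟩ := mem_arc.1 hx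
  push_cast at g2
  refine Finset.mem_inter.2 ⟨hxI, ?_⟩
  have n1 : i ≠ a := by rintro rfl; exact hn _ h1 hxI
  have n2 : i ≠ a + 2 * m₁ + 1 := by rintro rfl; exact hn _ h2 hxI
  have n3 : i ≠ a + 2 * m₁ + 2 * m₂ + 2 := by rintro rfl; exact hn _ h3 hxI
  have hwin := fun (b i : ℤ) (k : ℕ) => h.cyc.mem_arc_iff (a := a) (b := b) (i := i) (k := k)
  push_cast at hwin
  rw [Finset.mem_union, Finset.mem_union, hwin _ _ (2 * m₁) (by omega) (by omega) (by omega)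
    (by omega), hwin _ _ (2 * m₂) (by omega) (by omega) (by omega) (by omega),
    hwin _ _ (2 * m₃) (by omega) (by omega) (by omega) (by omega)]
  omega

end IsShortest

end

section

variable {V : Type*} {H : SimpleGraph V}

/-- `p`, `q`, `r`, `s` are the four distinct vertices off the cycle `c`. -/
structure IsOuter (c : ℤ → V) (p q r s : V) : Prop where
  ne_pq : p ≠ q
  ne_pr : p ≠ r
  ne_ps : p ≠ s
  ne_qr : q ≠ r
  ne_qs : q ≠ s
  ne_rs : r ≠ s
  out_iff : ∀ v, (∀ i, c i ≠ v) ↔ v = p ∨ v = q ∨ v = r ∨ v = s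

namespace IsOuter

variable {c : ℤ → V} {p q r s : V}

theorem flip (h : IsOuter c p q r s) : IsOuter c q p s r :=
  ⟨h.ne_pq.symm, h.ne_qs, h.ne_qr, h.ne_ps, h.ne_pr, h.ne_rs.symm,
    fun v => (h.out_iff v).trans (by tauto)⟩

theorem flip_right (h : IsOuter c p q r s) : IsOuter c p q s r :=
  ⟨h.ne_pq, h.ne_ps, h.ne_pr, h.ne_qs, h.ne_qr, h.ne_rs.symm,
    fun v => (h.out_iff v).trans (by tauto)⟩

theorem flip_left (h : IsOuter c p q r s) : IsOuter c q p r s := h.flip_right.flip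

theorem swap (h : IsOuter c p q r s) : IsOuter c r s p q :=
  ⟨h.ne_rs, h.ne_pr.symm, h.ne_qr.symm, h.ne_ps.symm, h.ne_qs.symm, h.ne_pq,
    fun v => (h.out_iff v).trans (by tauto)⟩

theorem swap_mid (h : IsOuter c p q r s) : IsOuter c p r q s :=
  ⟨h.ne_pr, h.ne_pq, h.ne_ps, h.ne_qr.symm, h.ne_rs, h.ne_qs,
    fun v => (h.out_iff v).trans (by tauto)⟩

theorem out (h : IsOuter c p q r s) : ∀ i, c i ≠ p := (h.out_iff p).2 (Or.inl rfl)

variable [DecidableEq V] [Fintype V] {l : ℕ}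

theorem restMatched (h : IsOuter c p q r s) (hc : IsShortest H l c) (hrs : H.Adj r s) :
    IsShortest.RestMatched H l c p q := by
  refine ⟨1, ?_⟩
  convert IsMatched.pair hrs using 1
  ext v
  have := h.out_iff v
  rw [← hc.notMem_iff] at this
  simp only [Finset.mem_sdiff, Finset.mem_univ, true_and, this, Finset.mem_insert,
    Finset.mem_singleton]
  constructor
  · tauto
  · rintro (rfl | rfl)
    · simp [h.ne_pr.symm, h.ne_qr.symm]
    · simp [h.ne_ps.symm, h.ne_qs.symm]

end IsOuter

/-- Two positions at distance two on the cycle carry neighbours of `u`, and the position between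
them carries a neighbour of `v`. -/
def Straddles (H : SimpleGraph V) (c : ℤ → V) (u v : V) : Prop :=
  ∃ j, H.Adj u (c (j - 1)) ∧ H.Adj u (c (j + 1)) ∧ H.Adj v (c j)

variable [DecidableEq V] [Fintype V]

/-- A shortest cycle `c` of length `2 * l + 1` in a graph with independence number at most `l + 1`
in which every clique is missed by an independent set of size `l + 1`. -/
structure IsTight (H : SimpleGraph V) (l : ℕ) (c : ℤ → V) : Prop extends IsShortest H l c where
  three_le : 3 ≤ l
  card_le : ∀ I : Finset V, H.IsIndepSet (I : Set V) → I.card ≤ l + 1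
  avoid : ∀ K : Finset V, H.IsClique (K : Set V) →
    ∃ I : Finset V, H.IsIndepSet (I : Set V) ∧ I.card = l + 1 ∧ Disjoint I K

namespace IsTight

variable {l : ℕ} {c : ℤ → V} {p q r s u u' v v' : V}

theorem not_simplicial (h : IsTight H l c) (w : V) :
    ¬∀ a b, H.Adj w a → H.Adj w b → a ≠ b → H.Adj a b := by
  intro hw
  classical
  obtain ⟨I, hI, hcard, hd⟩ := h.avoid (Finset.univ.filter fun x => x = w ∨ H.Adj w x) (by
    intro a ha b hb hab
    simp only [Finset.coe_filter, Finset.mem_univ, true_and, Set.mem_ofPred_eq] at ha hb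
    rcases ha with rfl | ha <;> rcases hb with rfl | hb
    · exact absurd rfl hab
    · exact hb
    · exact ha.symm
    · exact hw a b ha hb hab)
  have hn : ∀ x ∈ I, x ≠ w ∧ ¬H.Adj w x := by
    intro x hx
    have := Finset.disjoint_left.1 hd hx
    simpa using this
  have := h.card_le (insert w I) (by
    rw [Finset.coe_insert]
    refine Set.Pairwise.insert hI fun b hb hbw => ⟨(hn b hb).2, fun hadj => (hn b hb).2 hadj.symm⟩)
  rw [Finset.card_insert_of_notMem fun hw => (hn w hw).1 rfl, hcard] at this
  omega

theorem not_triangle (h : IsTight H l c) (ho : IsOuter c p q r s) (hpq : H.Adj p q)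
    (hqr : H.Adj q r) (hpr : H.Adj p r) : False := by
  by_cases hs : ∃ i, H.Adj s (c i)
  · obtain ⟨i, hi⟩ := hs
    have hL := h.cyc.isMatched_arc (i + 1) (k := l) (by omega)
    have hsc : ∀ i, c i ≠ s := ho.swap.flip.out
    have hn : c i ∉ arc c (i + 1) (2 * l) := by
      have := h.cyc.disjoint_arc (a := i) (b := i + 1) (j := 1) (k := 2 * l) (by simp)
        (by push_cast; omega)
      exact Finset.disjoint_left.1 this (mem_arc.2 ⟨i, le_rfl, by simp, rfl⟩)
    have hsn : s ∉ arc c (i + 1) (2 * l) := fun hm => by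
      obtain ⟨j, -, -, hj⟩ := mem_arc.1 hm
      exact hsc j hj
    have hR := hL.insert hi hsn hn
    have key := IsCyc.of_path (H := H) (L := 2 * 1 + 1)
      (p := fun t => if t = 0 then p else if t = 1 then q else r) (by omega) ?_ ?_ ?_
    · have := h.min _ _ key.1 ⟨_, by
        convert hR using 1
        rw [key.2]
        ext v
        have hv := ho.out_iff v
        have hv' : v ∈ insert (c i) (arc c (i + 1) (2 * l)) ↔ ¬∀ i, c i ≠ v := by
          rw [← h.notMem_iff, not_not, h.cyc.arc_full (by omega) 0 i, add_comm (2 * l) 1, arc_add]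
          simp [arc]
        rw [Finset.mem_insert, hv', hv]
        simp only [Finset.mem_sdiff, Finset.mem_univ, true_and, Finset.mem_image, Finset.mem_range]
        constructor
        · intro hne
          by_contra hcon
          apply hne
          push Not at hcon
          rcases hcon.2 with rfl | rfl | rfl | rfl
          · exact ⟨0, by simp⟩
          · exact ⟨1, by simp⟩
          · exact ⟨2, by simp⟩
          · exact absurd rfl hcon.1
        · rintro hv ⟨t, ht, rfl⟩
          interval_cases t <;> simp [ho.ne_ps, ho.ne_qs, ho.ne_rs] at hv⟩
      have := h.three_le
      omega
    · intro i hi j hj hij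
      have := ho.ne_pq
      have := ho.ne_pr
      have := ho.ne_qr
      interval_cases i <;> interval_cases j <;> simp_all
    · intro i hi
      have : i = 0 ∨ i = 1 := by omega
      rcases this with rfl | rfl <;> simpa
    · simpa using hpr.symm
  · push Not at hs
    have hn : ∀ a, H.Adj s a → a = p ∨ a = q ∨ a = r := by
      intro a ha
      have := (ho.out_iff a).1 (by rintro i rfl; exact hs i ha)
      have := ha.ne'
      tauto
    refine h.not_simplicial s fun a b ha hb hab => ?_
    rcases hn a ha with rfl | rfl | rfl <;> rcases hn b hb with rfl | rfl | rfl <;>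
      first | exact absurd rfl hab | assumption | (apply SimpleGraph.Adj.symm; assumption)

theorem oddTriple_or (h : IsTight H l c) (ho : IsOuter c p q r s) (hpq : ¬H.Adj p q) :
    OddTriple l c fun v => H.Adj p v ∨ H.Adj q v := by
  by_contra hA
  obtain ⟨I, hIC, hI, hcard, hIn⟩ := h.exists_indep hA
  have hnot : ∀ v, (∀ i, c i ≠ v) → v ∉ I := fun v hv hvI => h.notMem_iff.2 hv (hIC hvI)
  have hq := hnot q ho.flip.out
  have hp : p ∉ insert q I := by simp [ho.ne_pq, hnot p ho.out]
  have := h.card_le (insert p (insert q I)) (by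
    rw [Finset.coe_insert, Finset.coe_insert]
    refine Set.Pairwise.insert (Set.Pairwise.insert hI fun b hb hbq => ?_) fun b hb hbp => ?_
    · have := hIn b hb
      exact ⟨fun h => this (Or.inr h), fun h => this (Or.inr h.symm)⟩
    · rcases hb with rfl | hb
      · exact ⟨hpq, fun h => hpq h.symm⟩
      · have := hIn b hb
        exact ⟨fun h => this (Or.inl h), fun h => this (Or.inl h.symm)⟩)
  rw [Finset.card_insert_of_notMem hp, Finset.card_insert_of_notMem hq] at this
  omega

theorem not_oddTriple (h : IsTight H l c) (ho : IsOuter c p q r s) (hpq : H.Adj p q)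
    (hrs : H.Adj r s) : ¬OddTriple l c (H.Adj p) ∨ ¬OddTriple l c (H.Adj q) := by
  by_contra! hcon
  obtain ⟨I, hI, hcard, hd⟩ := h.avoid {r, s} (by simpa using fun _ => hrs)
  simp only [Finset.disjoint_insert_right, Finset.disjoint_singleton_right] at hd
  have hsub : ∀ x ∈ I, x ∉ arc c 0 (2 * l + 1) → x = p ∨ x = q := by
    intro x hx hxC
    rcases (ho.out_iff x).1 (h.notMem_iff.1 hxC) with rfl | rfl | rfl | rfl
    · exact Or.inl rfl
    · exact Or.inr rfl
    · exact absurd hx hd.1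
    · exact absurd hx hd.2
  have key : ∀ w, OddTriple l c (H.Adj w) → w ∈ I → (∀ x ∈ I, x ∉ arc c 0 (2 * l + 1) → x = w) →
      False := by
    intro w hw hwI hall
    have h1 := h.card_inter_lt hw hI hwI
    have h2 : I ⊆ insert w (I ∩ arc c 0 (2 * l + 1)) := by
      intro x hx
      by_cases hxC : x ∈ arc c 0 (2 * l + 1)
      · simp [hx, hxC]
      · simp [hall x hx hxC]
    have := Finset.card_le_card h2
    have := Finset.card_insert_le w (I ∩ arc c 0 (2 * l + 1))
    omega
  by_cases hp : p ∈ I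
  · have hq : q ∉ I := fun hq => hI hp hq ho.ne_pq hpq
    refine key p hcon.1 hp fun x hx hxC => (hsub x hx hxC).resolve_right ?_
    rintro rfl
    exact hq hx
  · by_cases hq : q ∈ I
    · refine key q hcon.2 hq fun x hx hxC => (hsub x hx hxC).resolve_left ?_
      rintro rfl
      exact hp hx
    · have h2 : I ⊆ I ∩ arc c 0 (2 * l + 1) := by
        intro x hx
        by_contra hxC
        rcases hsub x hx (fun h => hxC (Finset.mem_inter.2 ⟨hx, h⟩)) with rfl | rfl
        · exact hp hx
        · exact hq hx
      have := Finset.card_le_card h2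
      have := h.cyc.indepLE 0 I hI
      omega

theorem eq_of_outer (h : IsTight H l c) (ho : IsOuter c u u' v v') (huu : H.Adj u u')
    (hvv : H.Adj v v') (huv : ¬H.Adj u v) {a : ℤ} {m m' : ℕ} (hm : m + m' < l)
    (hua : H.Adj u (c a)) (hub : H.Adj u (c (a + 2 * m + 1)))
    (hvb : H.Adj v (c (a + 2 * m + 2 * m' + 2))) : m + 1 = l := by
  by_contra hne
  have hl := h.three_le
  have hu := ho.out
  have hu' := ho.flip.out
  have hv := ho.swap.out
  have hv' := ho.swap.flip.out
  have n1 : ¬H.Adj u' v' := fun hadj =>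
    hne (h.eq_of_three hu hv (ho.swap_mid.restMatched h.toIsShortest hadj) ho.ne_pr hm hua hub hvb)
  have n2 : ∀ i, ¬H.Adj u' (c i) := by
    intro i hi
    obtain ⟨j, hj1, hj2, hij⟩ := h.rep a i
    rw [hij] at hi
    have hX := ho.restMatched h.toIsShortest hvv
    have d1 := h.adj_diff hu hu' hX huu hua hi (by omega) (by omega)
    have d2 := h.adj_diff hu hu' hX huu hub hi (by omega) (by omega)
    obtain ⟨t, ht | ht⟩ := Int.even_or_odd' (j - a)
    · refine hne (h.eq_of_three hu hu' hX ho.ne_pq (m' := (t - m - 1).toNat) (by omega) hua hub ?_)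
      convert hi using 2
      omega
    · omega
  have hnu' : ∀ x, H.Adj u' x → x = u ∨ x = v := by
    intro x hx
    rcases (ho.out_iff x).1 (by rintro i rfl; exact n2 i hx) with rfl | rfl | rfl | rfl
    · exact Or.inl rfl
    · exact absurd rfl hx.ne
    · exact Or.inr rfl
    · exact absurd hx n1
  have n3 : H.Adj u' v := by
    by_contra hn
    refine h.not_simplicial u' fun x y hx hy hxy => absurd ?_ hxy
    rcases hnu' x hx with rfl | rfl
    · rcases hnu' y hy with rfl | rfl
      · rfl
      · exact absurd hy hn
    · exact absurd hx hn
  have n4 : OddTriple l c (H.Adj v') :=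
    (h.oddTriple_or (ho.flip.swap_mid) n1).imp
      fun i hi => hi.resolve_left (n2 i)
  have hX : IsShortest.RestMatched H l c v' u :=
    (ho.flip_right.swap_mid.restMatched h.toIsShortest n3).symm
  have := h.eq_of_oddTriple (by omega) hv' hu hX ho.ne_ps.symm n4 hua hub
  have := h.cyc.eq_of_lt this (by push_cast; omega) (by push_cast; omega)
  omega

theorem straddles_of_three (h : IsTight H l c) (ho : IsOuter c u u' v v') (huu : H.Adj u u')
    (hvv : H.Adj v v') (huv : ¬H.Adj u v) {a : ℤ} {m₁ m₂ m₃ : ℕ} (hm : m₁ + m₂ + m₃ + 1 = l)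
    (h1 : H.Adj u (c a)) (h2 : H.Adj u (c (a + 2 * m₁ + 1)))
    (h3 : H.Adj v (c (a + 2 * m₁ + 2 * m₂ + 2))) : Straddles H c u v := by
  have := h.eq_of_outer ho huu hvv huv (m := m₁) (m' := m₂) (by omega) h1 h2 h3
  refine ⟨a + 2 * m₁ + 2 * m₂ + 2, by convert h2 using 2; omega, ?_, h3⟩
  rw [← h.periodic] at h1
  convert h1 using 2
  omega

theorem straddles_or (h : IsTight H l c) (ho : IsOuter c u u' v v') (huu : H.Adj u u')
    (hvv : H.Adj v v') (huv : ¬H.Adj u v) (hu : ¬OddTriple l c (H.Adj u))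
    (hv : ¬OddTriple l c (H.Adj v)) : Straddles H c u v ∨ Straddles H c v u := by
  have k1 := fun (a : ℤ) (m₁ m₂ m₃ : ℕ) => h.straddles_of_three ho huu hvv huv (a := a) (m₁ := m₁)
    (m₂ := m₂) (m₃ := m₃)
  have k2 := fun (a : ℤ) (m₁ m₂ m₃ : ℕ) => h.straddles_of_three ho.swap hvv huu
    (fun h => huv h.symm) (a := a) (m₁ := m₁) (m₂ := m₂) (m₃ := m₃)
  obtain ⟨a, m₁, m₂, m₃, hm, h1, h2, h3⟩ := h.oddTriple_or ho.swap_mid huv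
  have e1 : c (a + 2 * m₁ + 2 * m₂ + 2 + 2 * m₃ + 1) = c a := by
    rw [← h.periodic a]
    congr 1
    omega
  have e2 : c (a + 2 * m₁ + 2 * m₂ + 2 + 2 * m₃ + 2 * m₁ + 2) = c (a + 2 * m₁ + 1) := by
    rw [← h.periodic (a + 2 * m₁ + 1)]
    congr 1
    omega
  have e3 : c (a + 2 * m₁ + 1 + 2 * m₂ + 1) = c (a + 2 * m₁ + 2 * m₂ + 2) := by
    congr 1
    omega
  have e4 : c (a + 2 * m₁ + 1 + 2 * m₂ + 2 * m₃ + 2) = c a := by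
    rw [← h.periodic a]
    congr 1
    omega
  rcases h1 with h1 | h1 <;> rcases h2 with h2 | h2 <;> rcases h3 with h3 | h3
  · exact absurd ⟨a, m₁, m₂, m₃, hm, h1, h2, h3⟩ hu
  · exact Or.inl (k1 _ _ _ _ hm h1 h2 h3)
  · exact Or.inl (k1 _ m₃ m₁ m₂ (by omega) h3 (by rwa [e1]) (by rwa [e2]))
  · exact Or.inr (k2 _ m₂ m₃ m₁ (by omega) h2 (by rwa [e3]) (by rwa [e4]))
  · exact Or.inl (k1 _ m₂ m₃ m₁ (by omega) h2 (by rwa [e3]) (by rwa [e4]))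
  · exact Or.inr (k2 _ m₃ m₁ m₂ (by omega) h3 (by rwa [e1]) (by rwa [e2]))
  · exact Or.inr (k2 _ _ _ _ hm h1 h2 h3)
  · exact absurd ⟨a, m₁, m₂, m₃, hm, h1, h2, h3⟩ hv

end IsTight

theorem Straddles.exists_rep (h : IsShortest H l c) {u v : V} (huv : Straddles H c u v) (a : ℤ) :
    ∃ j, a ≤ j ∧ j < a + (2 * l + 1) ∧ H.Adj u (c (j - 1)) ∧ H.Adj u (c (j + 1)) ∧
      H.Adj v (c j) := by
  obtain ⟨i, h1, h2, h3⟩ := huv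
  obtain ⟨j, g1, g2, hij⟩ := h.rep a i
  have key : ∀ t : ℤ, c (i + t) = c (j + t) := fun t =>
    (h.cyc.eq_iff _ _).2 (by simpa using (h.cyc.eq_iff _ _).1 hij)
  exact ⟨j, g1, g2, by simpa only [sub_eq_add_neg, key] using h1, by rwa [← key], by rwa [← hij]⟩

namespace IsTight

theorem not_straddles (h : IsTight H l c) {x y z w : V} (ho : IsOuter c x y z w) (hxy : H.Adj x y)
    (hzw : H.Adj z w) (hxz : ¬H.Adj x z) (hx : ¬OddTriple l c (H.Adj x))
    (hz : ¬OddTriple l c (H.Adj z)) : ¬Straddles H c x z := by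
  rintro ⟨o, hx1, hx2, hz0⟩
  have hl := h.three_le
  have hs := h.toIsShortest
  have hXxy := ho.restMatched hs hzw
  have hXzw := ho.swap.restMatched hs hxy
  have hy : ¬OddTriple l c (H.Adj y) :=
    h.not_oddTriple_of_adj (by omega) ho.flip.out ho.out hXxy.symm hxy.symm hx1
  have hw : ¬OddTriple l c (H.Adj w) :=
    h.not_oddTriple_of_adj (by omega) ho.swap.flip.out ho.swap.out hXzw.symm hzw.symm hz0
  have dx : ∀ (j : ℤ) (v : V), (∀ i, c i ≠ v) → IsShortest.RestMatched H l c x v → H.Adj x v →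
      H.Adj v (c j) → o - l - 1 ≤ j → j ≤ o + l + 1 → j = o ∨ j = o + 2 ∨ j = o - 2 := by
    intro j v hv hX hxv hj g1 g2
    have d1 := h.adj_diff ho.out hv hX hxv hx1 hj (by omega) (by omega)
    have d2 := h.adj_diff ho.out hv hX hxv hx2 hj (by omega) (by omega)
    omega
  have dz := fun j : ℤ => h.adj_diff (j := j) ho.swap.out ho.swap.flip.out hXzw hzw hz0
  have x0 : ¬H.Adj x (c o) := fun h0 => hx ⟨o - 1, 0, 0, l - 1, by omega, hx1, by simpa using h0, by
    convert hx2 using 2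
    push_cast
    ring⟩
  have x2 : ¬H.Adj x (c (o + 2)) := fun h0 => by
    have := h.eq_of_outer ho hxy hzw hxz (a := o + 1) (m := 0) (m' := l - 1) (by omega) hx2
      (by convert h0 using 2; push_cast; ring)
      (by rw [← h.periodic] at hz0; convert hz0 using 2; push_cast; omega)
    omega
  have x2' : ¬H.Adj x (c (o - 2)) := fun h0 => by
    have := h.eq_of_outer ho hxy hzw hxz (a := o - 2) (m := 0) (m' := 0) (by omega) h0
      (by convert hx1 using 2; push_cast; ring) (by convert hz0 using 2; push_cast; ring)
    omega
  have z1 : ¬H.Adj z (c (o + 1)) := fun h0 => by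
    have := h.eq_of_outer ho.swap hzw hxy (fun h => hxz h.symm) (a := o) (m := 0) (m' := l - 1)
      (by omega) hz0 (by convert h0 using 2; push_cast; ring)
      (by rw [← h.periodic] at hx1; convert hx1 using 2; push_cast; omega)
    omega
  have z1' : ¬H.Adj z (c (o - 1)) := fun h0 => by
    have := h.eq_of_outer ho.swap hzw hxy (fun h => hxz h.symm) (a := o - 1) (m := 0) (m' := 0)
      (by omega) h0 (by convert hz0 using 2; push_cast; ring)
      (by convert hx2 using 2; push_cast; ring)
    omega
  have hxw : H.Adj x w := by
    by_contra hxw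
    rcases h.straddles_or ho.flip_right hxy hzw.symm hxw hx hw with hS | hS
    · obtain ⟨k, g1, g2, a1, a2, a3⟩ := hS.exists_rep hs (o - l)
      have d := dz k a3 (by omega) (by omega)
      have : k - 1 = o ∨ k + 1 = o ∨ k - 1 = o + 2 ∨ k + 1 = o - 2 := by omega
      rcases this with e | e | e | e
      · exact x0 (e ▸ a1)
      · exact x0 (e ▸ a2)
      · exact x2 (e ▸ a1)
      · exact x2' (e ▸ a2)
    · obtain ⟨k, g1, g2, a1, a2, a3⟩ := hS.exists_rep hs (o - l)
      have d1 := dz _ a1 (by omega) (by omega)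
      have d2 := dz _ a2 (by omega) (by omega)
      have : k = o ∨ k = o + 2 ∨ k = o - 2 := by omega
      rcases this with rfl | rfl | rfl
      exacts [x0 a3, x2 a3, x2' a3]
  have hyz : H.Adj y z := by
    by_contra hyz
    rcases h.straddles_or ho.flip_left hxy.symm hzw hyz hy hz with hS | hS
    · obtain ⟨k, g1, g2, a1, a2, a3⟩ := hS.exists_rep hs (o - l)
      have d1 := dx _ y ho.flip.out hXxy hxy a1 (by omega) (by omega)
      have d2 := dx _ y ho.flip.out hXxy hxy a2 (by omega) (by omega)
      have : k = o + 1 ∨ k = o - 1 := by omega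
      rcases this with rfl | rfl
      exacts [z1 a3, z1' a3]
    · obtain ⟨k, g1, g2, a1, a2, a3⟩ := hS.exists_rep hs (o - l)
      have d := dx k y ho.flip.out hXxy hxy a3 (by omega) (by omega)
      have : k + 1 = o + 1 ∨ k - 1 = o + 1 ∨ k + 1 = o - 1 := by omega
      rcases this with e | e | e
      · exact z1 (e ▸ a2)
      · exact z1 (e ▸ a1)
      · exact z1' (e ▸ a2)
  have hyw : ¬H.Adj y w := fun hyw => h.not_triangle ho.flip_right hxy hyw hxw
  have hwc : ∀ i, ¬H.Adj w (c i) := by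
    intro i hi
    obtain ⟨j, g1, g2, hij⟩ := hs.rep (o - l) i
    rw [hij] at hi
    have d1 := dx j w ho.swap.flip.out (ho.flip_right.swap_mid.restMatched hs hyz) hxw hi (by omega)
      (by omega)
    have d2 := dz j hi (by omega) (by omega)
    omega
  rcases h.straddles_or ho.flip hxy.symm hzw.symm hyw hy hw with ⟨k, -, -, h3⟩ | ⟨k, h3, -, -⟩
  · exact hwc _ h3
  · exact hwc _ h3

theorem adj_of_not_oddTriple (h : IsTight H l c) {x y z w : V} (ho : IsOuter c x y z w)
    (hxy : H.Adj x y) (hzw : H.Adj z w) (hx : ¬OddTriple l c (H.Adj x))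
    (hz : ¬OddTriple l c (H.Adj z)) : H.Adj x z := by
  by_contra hxz
  rcases h.straddles_or ho hxy hzw hxz hx hz with hS | hS
  · exact h.not_straddles ho hxy hzw hxz hx hz hS
  · exact h.not_straddles ho.swap hzw hxy (fun h => hxz h.symm) hz hx hS

theorem false_of_outer (h : IsTight H l c) {x y z w : V} (ho : IsOuter c x y z w)
    (hxy : H.Adj x y) (hzw : H.Adj z w) : False := by
  have hl := h.three_le
  have key : ∀ x y z w, IsOuter c x y z w → H.Adj x y → H.Adj z w → ¬OddTriple l c (H.Adj x) →
      ¬OddTriple l c (H.Adj z) → False := by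
    intro x y z w ho hxy hzw hx hz
    have hxz := h.adj_of_not_oddTriple ho hxy hzw hx hz
    by_cases hy : OddTriple l c (H.Adj y)
    · have hw := h.not_oddTriple_of_oddTriple (by omega) ho.flip.out ho.swap.flip.out
        (ho.flip.swap_mid.restMatched h.toIsShortest hxz) ho.ne_qs hy
      exact h.not_triangle ho.swap_mid.flip_right hxz hzw
        (h.adj_of_not_oddTriple ho.flip_right hxy hzw.symm hx hw)
    · exact h.not_triangle ho hxy (h.adj_of_not_oddTriple ho.flip_left hxy.symm hzw hy hz) hxz
  rcases h.not_oddTriple ho hxy hzw with hx | hy <;>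
    rcases h.not_oddTriple ho.swap hzw hxy with hz | hw
  · exact key _ _ _ _ ho hxy hzw hx hz
  · exact key _ _ _ _ ho.flip_right hxy hzw.symm hx hw
  · exact key _ _ _ _ ho.flip_left hxy.symm hzw hy hz
  · exact key _ _ _ _ ho.flip hxy.symm hzw.symm hy hw

end IsTight

end

section

variable {V : Type*} {H : SimpleGraph V}

theorem isCyc_zpow {σ : Equiv.Perm V} (hσ : ∀ v, H.Adj v (σ v)) (x : V) :
    IsCyc H (Function.minimalPeriod σ x) (fun i : ℤ => (σ ^ i) x) := by
  refine ⟨fun i j => ?_, fun i => ?_⟩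
  · have := MulAction.zpow_smul_eq_iff_minimalPeriod_dvd (a := σ) (b := x) (n := j - i)
    simp only [Equiv.Perm.smul_def] at this
    have h2 : (fun y => σ y) = (σ : V → V) := rfl
    rw [← this]
    rw [sub_eq_neg_add, zpow_add, Equiv.Perm.mul_apply, zpow_neg, Equiv.Perm.inv_eq_iff_eq]
    exact eq_comm
  · have := hσ ((σ ^ i) x)
    rwa [← Equiv.Perm.mul_apply, ← zpow_one_add, add_comm] at this

variable [DecidableEq V] [Fintype V] {n : ℕ}

theorem exists_cover_of_cycle (hn : 4 ≤ n) (hV : Fintype.card V = 2 * n + 3)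
    (hα : ∀ I : Finset V, H.IsIndepSet (I : Set V) → I.card ≤ n)
    (hf : ∀ K : Finset V, H.IsClique (K : Set V) →
      ∃ I : Finset V, H.IsIndepSet (I : Set V) ∧ I.card = n ∧ Disjoint I K)
    (hc : ∃ (l : ℕ) (c : ℤ → V), IsCyc H (2 * l + 1) c ∧
      ∃ k, IsMatched H k (Finset.univ \ arc c 0 (2 * l + 1))) :
    ∃ U : Finset V, CliqueCovered H 3 U ∧ IndepLE H (Finset.univ \ U) (n - 2) := by
  classical
  obtain ⟨c, hcyc, k, hk⟩ := Nat.find_spec hc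
  have hmin : ∀ (l' : ℕ) (c' : ℤ → V), IsCyc H (2 * l' + 1) c' →
      (∃ k, IsMatched H k (Finset.univ \ arc c' 0 (2 * l' + 1))) → Nat.find hc ≤ l' :=
    fun l' c' h1 h2 => Nat.find_min' hc ⟨c', h1, h2⟩
  generalize Nat.find hc = l at *
  have hs : IsShortest H l c := ⟨hcyc, ⟨k, hk⟩, hmin⟩
  have hcard := hk.card
  rw [Finset.card_sdiff_of_subset (Finset.subset_univ _), Finset.card_univ,
    hcyc.card_arc le_rfl, hV] at hcard
  have hle : 2 * l + 1 ≤ 2 * n + 3 := by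
    have := Finset.card_le_univ (arc c 0 (2 * l + 1))
    rwa [hcyc.card_arc le_rfl, hV] at this
  rcases Nat.lt_or_ge k 3 with hk3 | hk3
  · exfalso
    have hmem : ∀ x, (∀ i, c i ≠ x) ↔ x ∈ Finset.univ \ arc c 0 (2 * l + 1) := fun x => by
      rw [← hs.notMem_iff]
      simp
    generalize Finset.univ \ arc c 0 (2 * l + 1) = X at hk hmem hcard
    interval_cases k
    · obtain ⟨I, -, hI, hIc, -⟩ := hs.exists_indep (A := fun _ => False)
        (by rintro ⟨a, m₁, m₂, m₃, -, h, -⟩; exact h)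
      have := hα I hI
      omega
    · rcases hk with _ | @⟨_, U, x, y, hxy, hx, hy, hU⟩
      cases hU
      have hmem' : ∀ v, (∀ i, c i ≠ v) ↔ v = x ∨ v = y := fun v => by
        rw [hmem]
        simp_all
      have hOT : ∀ u, (∀ i, c i ≠ u) → OddTriple l c (H.Adj u) := by
        intro u hu
        by_contra hA
        obtain ⟨I, hIC, hI, hcardI, hIn⟩ := hs.exists_indep hA
        have := hα (insert u I) (by
          rw [Finset.coe_insert]
          exact Set.Pairwise.insert hI fun b hb _ => ⟨hIn b hb, fun h => hIn b hb h.symm⟩)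
        rw [Finset.card_insert_of_notMem fun h => hs.notMem_iff.2 hu (hIC h)] at this
        omega
      have hxo := (hmem' x).2 (Or.inl rfl)
      have hyo := (hmem' y).2 (Or.inr rfl)
      refine hs.not_oddTriple_of_oddTriple (by omega) hxo hyo ⟨0, ?_⟩ hxy.ne (hOT x hxo) (hOT y hyo)
      suffices hE : (Finset.univ \ arc c 0 (2 * l + 1)) \ {x, y} = ∅ by
        rw [hE]
        exact .empty
      ext v
      have := hmem' v
      rw [← hs.notMem_iff] at this
      simp only [Finset.mem_sdiff, Finset.mem_univ, true_and, Finset.mem_insert, Finset.mem_singleton,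
        Finset.notMem_empty]
      tauto
    · rcases hk with _ | @⟨_, U, x, y, hxy, hx, hy, hU⟩
      rcases hU with _ | @⟨_, W, z, w, hzw, hz, hw, hW⟩
      cases hW
      have ht : IsTight H l c := ⟨hs, by omega, fun I hI => by have := hα I hI; omega, fun K hK => by
        obtain ⟨I, h1, h2, h3⟩ := hf K hK
        exact ⟨I, h1, by omega, h3⟩⟩
      have hmem' : ∀ v, (∀ i, c i ≠ v) ↔ v = x ∨ v = y ∨ v = z ∨ v = w := fun v => by
        rw [hmem]
        simp_all
      simp only [Finset.mem_insert, Finset.notMem_empty, or_false, not_or] at hx hy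
      exact ht.false_of_outer ⟨hxy.ne, hx.1, hx.2, hy.1, hy.2, hzw.ne, hmem'⟩ hxy hzw
  · obtain ⟨U₁, U₂, h1, h2, hU⟩ := IsMatched.split (j := 3) (k := k - 3)
      (by rwa [Nat.add_sub_cancel' hk3])
    refine ⟨U₁, h1.cliqueCovered, ((hcyc.indepLE 0).union h2.indepLE).mono ?_ (by omega)⟩
    intro v hv
    have : v ∈ arc c 0 (2 * l + 1) ∨ v ∈ U₁ ∪ U₂ := by
      rw [hU]
      simp [em]
    simp at *
    tauto

/-- A graph in which every vertex is missed by a maximum independent set has a permutation of its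
vertices along edges. -/
theorem exists_perm_adj (hα : ∀ I : Finset V, H.IsIndepSet (I : Set V) → I.card ≤ n)
    (hf : ∀ v, ∃ I : Finset V, H.IsIndepSet (I : Set V) ∧ I.card = n ∧ v ∉ I) :
    ∃ σ : Equiv.Perm V, ∀ v, H.Adj v (σ v) := by
  classical
  let N : V → Finset V := fun v => Finset.univ.filter (H.Adj v)
  have hN : ∀ s : Finset V, ∀ x, x ∈ s.biUnion N ↔ ∃ v ∈ s, H.Adj v x := by simp [N]
  have hall : ∀ s : Finset V, s.card ≤ (s.biUnion N).card := by
    intro s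
    induction s using Finset.strongInduction with
    | H s ih =>
    by_contra! hlt
    have hind : ∀ u ∈ s, u ∉ s.biUnion N := by
      by_contra! hcon
      obtain ⟨u, hu, huN⟩ := hcon
      have h1 := ih (s \ s.biUnion N) (Finset.ssubset_iff_subset_ne.2
        ⟨Finset.sdiff_subset, fun h => (Finset.mem_sdiff.1 (h ▸ hu)).2 huN⟩)
      have h2 : (s \ s.biUnion N).biUnion N ⊆ s.biUnion N \ s := by
        intro x hx
        obtain ⟨v, hv, hvx⟩ := (hN _ _).1 hx
        rw [Finset.mem_sdiff] at hv ⊢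
        exact ⟨(hN _ _).2 ⟨v, hv.1, hvx⟩, fun hxs => hv.2 ((hN _ _).2 ⟨x, hxs, hvx.symm⟩)⟩
      have h3 := Finset.card_le_card h2
      have h4 := Finset.card_sdiff_add_card_inter s (s.biUnion N)
      have h5 := Finset.card_sdiff_add_card_inter (s.biUnion N) s
      rw [Finset.inter_comm] at h5
      omega
    obtain ⟨v, hv⟩ : s.Nonempty := Finset.card_pos.1 (by omega)
    obtain ⟨S, hS, hSn, hvS⟩ := hf v
    have h1 := hα ((S \ s.biUnion N) ∪ s) (by
      intro x hx y hy hxy hadj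
      simp only [Finset.coe_union, Set.mem_union, Finset.mem_coe, Finset.mem_sdiff] at hx hy
      rcases hx with hx | hx <;> rcases hy with hy | hy
      · exact hS hx.1 hy.1 hxy hadj
      · exact hx.2 ((hN _ _).2 ⟨y, hy, hadj.symm⟩)
      · exact hy.2 ((hN _ _).2 ⟨x, hx, hadj⟩)
      · exact hind y hy ((hN _ _).2 ⟨x, hx, hadj⟩))
    have h2 := ih (s ∩ S) (Finset.ssubset_iff_subset_ne.2 ⟨Finset.inter_subset_left,
      fun h => hvS (Finset.mem_inter.1 (h.symm ▸ hv)).2⟩)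
    have h3 : (S ∩ s.biUnion N) ∪ (s ∩ S).biUnion N ⊆ s.biUnion N := by
      refine Finset.union_subset Finset.inter_subset_right ?_
      exact Finset.biUnion_subset_biUnion_of_subset_left _ Finset.inter_subset_left
    have h4 : Disjoint (S ∩ s.biUnion N) ((s ∩ S).biUnion N) := by
      rw [Finset.disjoint_left]
      intro x hx hx'
      obtain ⟨z, hz, hzx⟩ := (hN _ _).1 hx'
      exact hS (Finset.mem_coe.2 (Finset.mem_inter.1 hz).2)
        (Finset.mem_coe.2 (Finset.mem_inter.1 hx).1) hzx.ne hzx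
    have h5 := Finset.card_le_card h3
    rw [Finset.card_union_of_disjoint h4] at h5
    have h6 := Finset.card_union_add_card_inter (S \ s.biUnion N) s
    have h7 : ((S \ s.biUnion N) ∩ s).card ≤ (s ∩ S).card :=
      Finset.card_le_card fun x hx => by
        simp only [Finset.mem_inter, Finset.mem_sdiff] at hx ⊢
        exact ⟨hx.2, hx.1.1⟩
    have h8 := Finset.card_sdiff_add_card_inter S (s.biUnion N)
    omega
  obtain ⟨f, hinj, hfN⟩ := (Finset.all_card_le_biUnion_card_iff_exists_injective N).1 hall
  exact ⟨Equiv.ofBijective f (Finite.injective_iff_bijective.1 hinj), fun v => by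
    simpa [N] using hfN v⟩

/-- `U` has a perfect matching, or it splits into an odd cycle, a matched part with `e` edges and a
remainder of size `2 * b + t` whose independent sets have at most `b` vertices. -/
def Decomposes (H : SimpleGraph V) (U : Finset V) : Prop :=
  (∃ k, IsMatched H k U) ∨
    ∃ (l : ℕ) (c : ℤ → V) (e : ℕ) (M R : Finset V) (b t : ℕ), IsCyc H (2 * l + 1) c ∧
      IsMatched H e M ∧ arc c 0 (2 * l + 1) ∪ M ∪ R = U ∧ Disjoint (arc c 0 (2 * l + 1)) M ∧
      Disjoint (arc c 0 (2 * l + 1) ∪ M) R ∧ IndepLE H R b ∧ R.card = 2 * b + t ∧ b ≤ t * (l + e)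

theorem decomposes_of_perm {σ : Equiv.Perm V} (hσ : ∀ v, H.Adj v (σ v)) (U : Finset V)
    (hU : ∀ v, σ v ∈ U ↔ v ∈ U) : Decomposes H U := by
  induction U using Finset.strongInduction with
  | H U ih =>
  rcases U.eq_empty_or_nonempty with rfl | ⟨x, hx⟩
  · exact Or.inl ⟨0, .empty⟩
  have hcyc := isCyc_zpow hσ x
  have hL : 0 < Function.minimalPeriod σ x :=
    Function.minimalPeriod_pos_of_mem_periodicPts
      (Function.Injective.mem_periodicPts σ.injective x)
  generalize Function.minimalPeriod σ x = L at hcyc hL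
  set c : ℤ → V := fun i => (σ ^ i) x with hc
  have hmem : ∀ v, v ∈ arc c 0 L ↔ ∃ i, c i = v := fun v => hcyc.mem_arc_full hL
  have hσc : ∀ i, σ (c i) = c (i + 1) := fun i => by
    rw [hc]
    simp only [add_comm i 1, zpow_one_add, Equiv.Perm.mul_apply]
  have hO : ∀ v, σ v ∈ arc c 0 L ↔ v ∈ arc c 0 L := by
    intro v
    rw [hmem, hmem]
    constructor
    · rintro ⟨i, hi⟩
      refine ⟨i - 1, σ.injective ?_⟩
      rw [hσc, ← hi, sub_add_cancel]
    · rintro ⟨i, rfl⟩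
      exact ⟨i + 1, (hσc i).symm⟩
  have hcU : ∀ t : ℕ, c t ∈ U := by
    intro t
    induction t with
    | zero => simpa [hc] using hx
    | succ t ih =>
      push_cast
      rwa [← hσc, hU]
  have hOU : arc c 0 L ⊆ U := by
    intro v hv
    obtain ⟨i, h1, -, rfl⟩ := mem_arc.1 hv
    lift i to ℕ using h1
    exact hcU i
  have hx' : x ∈ arc c 0 L := (hmem x).2 ⟨0, by simp [hc]⟩
  have hrec := ih (U \ arc c 0 L) (Finset.ssubset_iff_subset_ne.2
    ⟨Finset.sdiff_subset, fun h => (Finset.mem_sdiff.1 (h ▸ hx)).2 hx'⟩)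
    (fun v => by rw [Finset.mem_sdiff, Finset.mem_sdiff, hU, hO])
  have hdO : Disjoint (U \ arc c 0 L) (arc c 0 L) := Finset.sdiff_disjoint
  have hUO : U \ arc c 0 L ∪ arc c 0 L = U := Finset.sdiff_union_of_subset hOU
  obtain ⟨m, hm | hm⟩ := Nat.even_or_odd' L
  · have hM : IsMatched H m (arc c 0 L) := by
      rw [hm]
      exact hcyc.isMatched_arc 0 hm.ge
    rcases hrec with ⟨k, hk⟩ | ⟨l', c', e, M, R, b, t, h1, h2, h3, h4, h5, h6, h7, h8⟩
    · exact Or.inl ⟨k + m, hUO ▸ hk.union hM hdO⟩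
    · rw [← h3] at hdO hUO
      simp only [Finset.disjoint_union_left] at hdO h5
      refine Or.inr ⟨l', c', e + m, M ∪ arc c 0 L, R, b, t, h1, h2.union hM hdO.1.2, ?_, ?_, ?_, h6,
        h7, h8.trans (Nat.mul_le_mul_left _ (by omega))⟩
      · rw [← hUO]
        ext v
        simp only [Finset.mem_union]
        tauto
      · exact Finset.disjoint_union_right.2 ⟨h4, hdO.1.1⟩
      · simp only [Finset.disjoint_union_left]
        exact ⟨h5.1, h5.2, hdO.2.symm⟩
  · rw [hm] at hcyc hdO hUO hrec
    rcases hrec with ⟨k, hk⟩ | ⟨l', c', e, M, R, b, t, h1, h2, h3, h4, h5, h6, h7, h8⟩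
    · refine Or.inr ⟨m, c, k, _, ∅, 0, 0, hcyc, hk, ?_, hdO.symm, ?_, indepLE_empty, by simp,
        by simp⟩
      · rw [Finset.union_empty, Finset.union_comm, hUO]
      · simp
    · rw [← h3] at hdO hUO
      simp only [Finset.disjoint_union_left] at hdO h5
      rcases le_total m l' with hml | hml
      · refine Or.inr ⟨l', c', e, M, R ∪ arc c 0 (2 * m + 1), b + m, t + 1, h1, h2, ?_, h4, ?_,
          h6.union (hcyc.indepLE 0), ?_, ?_⟩
        · rw [← hUO]
          ext v
          simp only [Finset.mem_union]
          tauto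
        · simp only [Finset.disjoint_union_left, Finset.disjoint_union_right]
          exact ⟨⟨h5.1, h5.2⟩, hdO.1.1, hdO.1.2⟩
        · rw [Finset.card_union_of_disjoint hdO.2, h7, hcyc.card_arc le_rfl]
          ring
        · nlinarith
      · refine Or.inr ⟨m, c, e, M, R ∪ arc c' 0 (2 * l' + 1), b + l', t + 1, hcyc, h2, ?_,
          hdO.1.2.symm, ?_, h6.union (h1.indepLE 0), ?_, ?_⟩
        · rw [← hUO]
          ext v
          simp only [Finset.mem_union]
          tauto
        · simp only [Finset.disjoint_union_left, Finset.disjoint_union_right]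
          exact ⟨⟨hdO.2.symm, h5.2⟩, hdO.1.1.symm, h4.symm⟩
        · rw [Finset.card_union_of_disjoint h5.1.symm, h7, h1.card_arc le_rfl]
          ring
        · nlinarith

theorem exists_cover {r : ℕ} (hr : 3 ≤ r) (hn : r + 1 ≤ n) (hV : Fintype.card V + r ≤ 2 * n + 6)
    (hα : ∀ I : Finset V, H.IsIndepSet (I : Set V) → I.card ≤ n)
    (hf : ∀ K : Finset V, H.IsClique (K : Set V) →
      ∃ I : Finset V, H.IsIndepSet (I : Set V) ∧ I.card = n ∧ Disjoint I K) :
    ∃ U : Finset V, CliqueCovered H r U ∧ IndepLE H (Finset.univ \ U) (n + 1 - r) := by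
  obtain ⟨σ, hσ⟩ := exists_perm_adj hα (fun v => by
    obtain ⟨I, h1, h2, h3⟩ := hf {v} (by simp)
    exact ⟨I, h1, h2, by simpa using h3⟩)
  obtain ⟨I, hI, hIn, -⟩ := hf ∅ (by simp)
  rcases decomposes_of_perm hσ Finset.univ (by simp) with
    ⟨k, hk⟩ | ⟨l, c, e, M, R, b, t, h1, h2, h3, h4, h5, h6, h7, h8⟩
  · have hcard := hk.card
    rw [Finset.card_univ] at hcard
    have hle := hk.indepLE I hI
    rw [Finset.inter_univ] at hle
    obtain ⟨U₁, U₂, g1, g2, hU⟩ := IsMatched.split (j := r) (k := k - r)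
      (by rwa [Nat.add_sub_cancel' (by omega)])
    refine ⟨U₁, g1.cliqueCovered, g2.indepLE.mono ?_ (by omega)⟩
    intro v hv
    have : v ∈ U₁ ∪ U₂ := hU ▸ Finset.mem_univ v
    simp at *
    tauto
  · have hle := (((h1.indepLE 0).union h2.indepLE).union h6) I hI
    rw [h3, Finset.inter_univ] at hle
    have hcard : 2 * l + 1 + 2 * e + (2 * b + t) = Fintype.card V := by
      rw [← Finset.card_univ, ← h3, Finset.card_union_of_disjoint h5,
        Finset.card_union_of_disjoint h4, h1.card_arc le_rfl, h2.card, h7]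
    rcases Nat.lt_or_ge n (l + e + b) with hlt | hge
    · obtain rfl : t = 0 := by omega
      obtain rfl : r = 3 := by omega
      rw [zero_mul] at h8
      have hR : R = ∅ := Finset.card_eq_zero.1 (by omega)
      subst hR
      refine exists_cover_of_cycle (n := n) (by omega) (by omega) hα hf ⟨l, c, h1, e, ?_⟩
      convert h2 using 1
      rw [← h3, Finset.union_empty, Finset.union_sdiff_cancel_left h4]
    · have hre : r - 1 ≤ l + e := by
        by_contra! hcon
        have hr5 : r ≤ 5 := by omega
        have ht : t ≤ 2 := by omega
        interval_cases t <;> omega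
      have ha := h1.isMatched_arc 1 (k := l) (by omega)
      have hsplit : arc c 0 (2 * l + 1) = {c 0} ∪ arc c 1 (2 * l) := by
        rw [add_comm, arc_add]
        simp [arc]
      have haM := ha.union h2 (by
        rw [hsplit, Finset.disjoint_union_left] at h4
        exact h4.2)
      obtain ⟨U₁, U₂, g1, g2, hU⟩ := IsMatched.split (j := r - 1) (k := l + e - (r - 1))
        (by rwa [Nat.add_sub_cancel' hre])
      refine ⟨{c 0} ∪ U₁, ?_, (g2.indepLE.union h6).mono ?_ (by omega)⟩
      · convert (cliqueCovered_singleton (H := H) (c 0)).union g1.cliqueCovered using 1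
        omega
      · intro v hv
        have hv' : v ∈ arc c 0 (2 * l + 1) ∪ M ∪ R := h3 ▸ Finset.mem_univ v
        rw [hsplit, Finset.union_assoc {c 0}, ← hU] at hv'
        simp at *
        tauto

end

/-- `G →v (2_r, p)`, where every color that is at least `r` stands for the last color. -/
def TwosArrow {V : Type*} (G : SimpleGraph V) (r p : ℕ) : Prop :=
  ∀ c : V → ℕ, (∃ u v, G.Adj u v ∧ c u = c v ∧ c u < r) ∨
    ∃ s : Finset V, G.IsNClique p s ∧ ∀ v ∈ s, r ≤ c v

theorem vArrow_iff_twosArrow {V : Type*} {G : SimpleGraph V} {r p : ℕ} :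
    VArrow G (List.replicate r 2 ++ [p]) ↔ TwosArrow G r p := by
  have hlen : (List.replicate r 2 ++ [p]).length = r + 1 := by simp
  classical
  constructor
  · intro h c
    obtain ⟨i, s, hs, hc⟩ := h fun v => ⟨min (c v) r, by omega⟩
    rw [List.get_eq_getElem, List.getElem_append] at hs
    have hc' : ∀ v ∈ s, min (c v) r = i := fun v hv => congrArg Fin.val (hc v hv)
    split_ifs at hs with hi
    · rw [List.length_replicate] at hi
      rw [List.getElem_replicate, SimpleGraph.isNClique_iff, Finset.card_eq_two] at hs
      obtain ⟨hs, u, v, huv, rfl⟩ := hs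
      have hu := hc' u (by simp)
      have hv := hc' v (by simp)
      exact Or.inl ⟨u, v, hs (by simp) (by simp) huv, by omega, by omega⟩
    · rw [List.length_replicate] at hi
      refine Or.inr ⟨s, by simpa using hs, fun v hv => ?_⟩
      have := hc' v hv
      omega
  · intro h c
    rcases h fun v => (c v : ℕ) with ⟨u, v, huv, hc, hr⟩ | ⟨s, hs, hc⟩
    · classical
      refine ⟨c u, {u, v}, ?_, ?_⟩
      · rw [List.get_eq_getElem, List.getElem_append_left (by simpa using hr),
          List.getElem_replicate, SimpleGraph.isNClique_iff]
        exact ⟨by simpa using fun _ => huv, Finset.card_pair huv.ne⟩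
      · intro w hw
        rcases Finset.mem_insert.1 hw with rfl | hw
        · rfl
        · rw [Finset.mem_singleton.1 hw]
          exact Fin.ext hc.symm
    · refine ⟨⟨r, by omega⟩, s, by simpa using hs, fun v hv => Fin.ext ?_⟩
      have h1 := hc v hv
      have h2 := (c v).isLt
      simp only
      omega

namespace TwosArrow

variable {V : Type*} {G : SimpleGraph V} {r p : ℕ}

theorem nonempty (h : TwosArrow G r p) (hp : 1 ≤ p) : Nonempty V := by
  rcases h fun _ => 0 with ⟨u, -⟩ | ⟨s, hs, -⟩
  · exact ⟨u⟩
  · obtain ⟨v, -⟩ := Finset.card_pos.1 (hs.card_eq.symm ▸ hp)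
    exact ⟨v⟩

theorem of_embedding {W : Type*} {G' : SimpleGraph W} (h : TwosArrow G r p) (e : G ↪g G') :
    TwosArrow G' r p := by
  intro c
  rcases h (c ∘ e) with ⟨u, v, huv, h1, h2⟩ | ⟨s, hs, h1⟩
  · exact Or.inl ⟨e u, e v, e.map_adj_iff.2 huv, h1, h2⟩
  · refine Or.inr ⟨s.map e.toEmbedding, ⟨?_, by simpa using hs.card_eq⟩, by simpa using h1⟩
    intro x hx y hy hxy
    simp only [Finset.coe_map, Set.mem_image] at hx hy
    obtain ⟨a, ha, rfl⟩ := hx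
    obtain ⟨b, hb, rfl⟩ := hy
    exact e.map_adj_iff.2 (hs.isClique ha hb fun hab => hxy (hab ▸ rfl))

/-- If a coloring misses one of the first `r + 1` colors, one color `2` can be spared. -/
theorem of_missing (h : TwosArrow G r p) {c : V → ℕ} {q : ℕ} (hq : q ≤ r) (hc : ∀ v, c v ≠ q) :
    (∃ u v, G.Adj u v ∧ c u = c v ∧ c u < r + 1) ∨
      ∃ s : Finset V, G.IsNClique p s ∧ ∀ v ∈ s, r + 1 ≤ c v := by
  rcases h fun v => if c v = r then q else c v with ⟨u, v, huv, h1, h2⟩ | ⟨s, hs, h1⟩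
  · refine Or.inl ⟨u, v, huv, ?_⟩
    have := hc u
    have := hc v
    split_ifs at h1 h2 <;> omega
  · refine Or.inr ⟨s, hs, fun v hv => ?_⟩
    have := hc v
    have := h1 v hv
    split_ifs at this <;> omega

theorem folkman_le [Fintype V] (h : TwosArrow G r p) {q : ℕ} (hG : G.CliqueFree q) :
    folkman (List.replicate r 2 ++ [p]) q ≤ Fintype.card V := by
  let e := SimpleGraph.Iso.comap (Fintype.equivFin V).symm G
  exact Nat.sInf_le ⟨G.comap (Fintype.equivFin V).symm, hG.comap e.isContained,
    vArrow_iff_twosArrow.2 (h.of_embedding e.symm.toEmbedding)⟩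

end TwosArrow

/-- The graph `G` with an additional vertex joined to everything. -/
def cone {V : Type*} (G : SimpleGraph V) : SimpleGraph (Option V) where
  Adj
    | some u, some v => G.Adj u v
    | none, none => False
    | _, _ => True
  symm := ⟨by rintro (_ | u) (_ | v) h <;> first | exact h.symm | trivial⟩
  loopless := ⟨by rintro (_ | u) h <;> first | exact h.ne rfl | exact h⟩

theorem cliqueFree_cone {V : Type*} {G : SimpleGraph V} {q : ℕ} (hG : G.CliqueFree q) :
    (cone G).CliqueFree (q + 1) := by
  classical
  intro s hs
  have h1 : G.IsClique (s.eraseNone : Set V) := by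
    intro u hu v hv huv
    simp only [Finset.mem_coe, Finset.mem_eraseNone] at hu hv
    exact hs.isClique hu hv (by simpa using huv)
  have h2 : q ≤ s.eraseNone.card := by
    have := Finset.card_insert_le none (s.eraseNone.map Function.Embedding.some)
    rw [Finset.card_map] at this
    have h3 : s ⊆ insert none (s.eraseNone.map Function.Embedding.some) := by
      rintro (_ | u) hu <;> simp [hu]
    have := Finset.card_le_card h3
    have := hs.card_eq
    omega
  exact hG.mono h2 _ ⟨h1, rfl⟩

theorem TwosArrow.cone {V : Type*} {G : SimpleGraph V} {r p : ℕ} (h : TwosArrow G r p) :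
    TwosArrow (cone G) (r + 1) p := by
  classical
  intro c
  have lift : ∀ s : Finset V, G.IsNClique p s → (∀ v ∈ s, r + 1 ≤ c (some v)) →
      ∃ s : Finset (Option V), (VertexFolkman.cone G).IsNClique p s ∧ ∀ v ∈ s, r + 1 ≤ c v := by
    intro s hs hc
    refine ⟨s.map Function.Embedding.some, ⟨?_, by simpa using hs.card_eq⟩, by simpa using hc⟩
    intro x hx y hy hxy
    simp only [Finset.coe_map, Set.mem_image, Function.Embedding.some_apply] at hx hy
    obtain ⟨u, hu, rfl⟩ := hx
    obtain ⟨v, hv, rfl⟩ := hy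
    exact hs.isClique hu hv (by simpa using hxy)
  by_cases h0 : c none ≤ r
  · by_cases hex : ∃ v, c (some v) = c none
    · obtain ⟨v, hv⟩ := hex
      exact Or.inl ⟨some v, none, trivial, hv, by omega⟩
    · push Not at hex
      rcases h.of_missing h0 hex with ⟨u, v, huv, h1, h2⟩ | ⟨s, hs, hc⟩
      · exact Or.inl ⟨some u, some v, huv, h1, h2⟩
      · exact Or.inr (lift s hs hc)
  · rcases h fun v => c (some v) with ⟨u, v, huv, h1, h2⟩ | ⟨s, hs, hc⟩
    · exact Or.inl ⟨some u, some v, huv, h1, by omega⟩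
    · by_cases hex : ∃ u ∈ s, c (some u) = r
      · obtain ⟨u, hu, hur⟩ := hex
        by_cases hex' : ∃ v ∈ s, v ≠ u ∧ c (some v) = r
        · obtain ⟨v, hv, hvu, hvr⟩ := hex'
          exact Or.inl ⟨some v, some u, hs.isClique hv hu hvu, by omega, by omega⟩
        · push Not at hex'
          refine Or.inr ⟨insert none ((s.erase u).map Function.Embedding.some), ⟨?_, ?_⟩, ?_⟩
          · intro x hx y hy hxy
            simp only [Finset.coe_insert, Finset.coe_map, Set.mem_insert_iff, Set.mem_image,
              Finset.mem_coe, Finset.mem_erase, Function.Embedding.some_apply] at hx hy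
            rcases hx with rfl | ⟨a, ha, rfl⟩ <;> rcases hy with rfl | ⟨b, hb, rfl⟩
            · exact absurd rfl hxy
            · trivial
            · trivial
            · exact hs.isClique ha.2 hb.2 (by simpa using hxy)
          · rw [Finset.card_insert_of_notMem (by simp), Finset.card_map,
              Finset.card_erase_add_one hu, hs.card_eq]
          · intro x hx
            simp only [Finset.mem_insert, Finset.mem_map, Finset.mem_erase,
              Function.Embedding.some_apply] at hx
            rcases hx with rfl | ⟨a, ⟨ha, has⟩, rfl⟩
            · omega
            · have := hex' a has ha
              have := hc a has
              omega
      · push Not at hex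
        exact Or.inr (lift s hs fun v hv => by
          have := hex v hv
          have := hc v hv
          omega)

/-- Disjoint copies of a complete graph together with, for every embedding `e` of the vertices of
`G` into them, a copy of `G` whose vertices are matched to their images under `e`. -/
def zykov {ι κ V : Type*} (G : SimpleGraph V) : SimpleGraph ((ι × κ) ⊕ ((V ↪ ι × κ) × V)) where
  Adj
    | .inl x, .inl y => x.1 = y.1 ∧ x.2 ≠ y.2
    | .inr u, .inr v => u.1 = v.1 ∧ G.Adj u.2 v.2
    | .inl x, .inr u => u.1 u.2 = x
    | .inr u, .inl x => u.1 u.2 = x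
  symm := ⟨by
    rintro (x | u) (y | v) h
    exacts [⟨h.1.symm, h.2.symm⟩, h, h, ⟨h.1.symm, h.2.symm⟩]⟩
  loopless := ⟨by
    rintro (x | u) h
    exacts [h.2 rfl, h.2.ne rfl]⟩

theorem cliqueFree_zykov {ι κ V : Type*} [Fintype κ] {G : SimpleGraph V} {q : ℕ} (hq : 3 ≤ q)
    (hκ : Fintype.card κ < q) (hG : G.CliqueFree q) : (zykov (ι := ι) (κ := κ) G).CliqueFree q := by
  classical
  intro s hs
  by_cases hl : ∃ x, Sum.inl x ∈ s
  · obtain ⟨x, hx⟩ := hl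
    by_cases hr : ∃ u, Sum.inr u ∈ s
    · obtain ⟨u, hu⟩ := hr
      have hux : u.1 u.2 = x := hs.isClique hx hu (by simp)
      have hsub : s ⊆ {Sum.inl x, Sum.inr u} := by
        rintro (y | v) hz
        · have huy : u.1 u.2 = y := hs.isClique hz hu (by simp)
          simp [← hux, huy]
        · have hvx : v.1 v.2 = x := hs.isClique hx hz (by simp)
          by_contra hne
          have hadj : u.1 = v.1 ∧ G.Adj u.2 v.2 := hs.isClique hu hz (by
            rintro h
            rw [← h] at hne
            simp at hne)
          rw [← hadj.1, ← hux] at hvx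
          exact hadj.2.ne (u.1.injective hvx).symm
      have := (Finset.card_le_card hsub).trans Finset.card_le_two
      have := hs.card_eq
      omega
    · push Not at hr
      have : s.card ≤ (Finset.univ : Finset κ).card := by
        refine Finset.card_le_card_of_injOn (Sum.elim Prod.snd fun _ => x.2) (by simp) ?_
        rintro (y | u) hy (z | v) hz hyz
        · by_contra hne
          have : y.1 = z.1 ∧ y.2 ≠ z.2 := hs.isClique hy hz hne
          exact this.2 hyz
        · exact absurd hz (hr v)
        · exact absurd hy (hr u)
        · exact absurd hz (hr v)
      rw [hs.card_eq, Finset.card_univ] at this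
      omega
  · push Not at hl
    obtain ⟨z, hz⟩ := Finset.card_pos.1 (hs.card_eq.symm ▸ (show 0 < q by omega))
    obtain ⟨w, rfl⟩ : ∃ w, z = Sum.inr w := by
      rcases z with x | w
      · exact absurd hz (hl x)
      · exact ⟨w, rfl⟩
    refine hG (s.image (Sum.elim (fun _ => w.2) Prod.snd)) ⟨?_, ?_⟩
    · intro a ha b hb hab
      simp only [Finset.coe_image, Set.mem_image, Finset.mem_coe] at ha hb
      obtain ⟨x | u, hu, rfl⟩ := ha
      · exact absurd hu (hl x)
      obtain ⟨y | v, hv, rfl⟩ := hb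
      · exact absurd hv (hl y)
      have : u.1 = v.1 ∧ G.Adj u.2 v.2 := hs.isClique hu hv fun h => hab (by rw [h])
      exact this.2
    · rw [Finset.card_image_of_injOn, hs.card_eq]
      rintro (x | u) hu (y | v) hv huv
      · exact absurd hu (hl x)
      · exact absurd hu (hl x)
      · exact absurd hv (hl y)
      · by_contra hne
        have : u.1 = v.1 ∧ G.Adj u.2 v.2 := hs.isClique hu hv hne
        exact this.2.ne huv

theorem TwosArrow.zykov {N r p : ℕ} {G : SimpleGraph (Fin N)} (h : TwosArrow G r p) :
    TwosArrow (zykov (ι := Fin ((r + 1) * N)) (κ := Fin p) G) (r + 1) p := by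
  classical
  intro c
  by_cases hex : ∃ i, ∀ a, r + 1 ≤ c (Sum.inl (i, a))
  · obtain ⟨i, hi⟩ := hex
    refine Or.inr ⟨Finset.univ.image fun a => Sum.inl (i, a), ⟨?_, ?_⟩, by simpa using hi⟩
    · intro x hx y hy hxy
      simp only [Finset.coe_image, Finset.coe_univ, Set.image_univ, Set.mem_range] at hx hy
      obtain ⟨a, rfl⟩ := hx
      obtain ⟨b, rfl⟩ := hy
      exact ⟨rfl, fun hab => hxy (by rw [show a = b from hab])⟩
    · rw [Finset.card_image_of_injective _ fun a b hab => by simpa using hab]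
      simp
  · push Not at hex
    choose a ha using hex
    obtain ⟨q, hq, hcard⟩ := Finset.exists_le_card_fiber_of_mul_le_card_of_maps_to
      (s := Finset.univ) (t := Finset.range (r + 1)) (f := fun i => c (Sum.inl (i, a i))) (n := N)
      (fun i _ => Finset.mem_range.2 (ha i)) (by simp) (by simp)
    rw [Finset.mem_range] at hq
    obtain ⟨T, hT, hTN⟩ := Finset.exists_subset_card_eq hcard
    let τ := T.orderEmbOfFin hTN
    have hτ : ∀ v, c (Sum.inl (τ v, a (τ v))) = q := fun v => by
      have := hT (T.orderEmbOfFin_mem hTN v)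
      simpa using this
    let e : Fin N ↪ Fin ((r + 1) * N) × Fin p :=
      ⟨fun v => (τ v, a (τ v)), fun u v huv => τ.injective (congrArg Prod.fst huv)⟩
    by_cases hv : ∃ v, c (Sum.inr (e, v)) = q
    · obtain ⟨v, hv⟩ := hv
      exact Or.inl ⟨Sum.inl (e v), Sum.inr (e, v), rfl, (hτ v).trans hv.symm, (hτ v).trans_lt hq⟩
    · push Not at hv
      rcases h.of_missing (Nat.lt_succ_iff.1 hq) hv with ⟨u, v, huv, h1, h2⟩ | ⟨s, hs, hc⟩
      · exact Or.inl ⟨Sum.inr (e, u), Sum.inr (e, v), ⟨rfl, huv⟩, h1, h2⟩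
      · refine Or.inr ⟨s.image fun v => Sum.inr (e, v), ⟨?_, ?_⟩, by simpa using hc⟩
        · intro x hx y hy hxy
          simp only [Finset.coe_image, Set.mem_image] at hx hy
          obtain ⟨u, hu, rfl⟩ := hx
          obtain ⟨v, hv, rfl⟩ := hy
          exact ⟨rfl, hs.isClique hu hv fun huv => hxy (by rw [huv])⟩
        · rw [Finset.card_image_of_injective _ fun u v huv => by simpa using huv, hs.card_eq]

theorem exists_twosArrow {p : ℕ} (hp : 2 ≤ p) (r : ℕ) :
    ∃ (N : ℕ) (G : SimpleGraph (Fin N)), G.CliqueFree (p + 1) ∧ TwosArrow G r p := by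
  classical
  induction r with
  | zero =>
    refine ⟨p, ⊤, SimpleGraph.cliqueFree_of_card_lt (by simp), fun c => Or.inr
      ⟨Finset.univ, ⟨?_, by simp⟩, by simp⟩⟩
    intro u _ v _ huv
    exact huv
  | succ r ih =>
    obtain ⟨N, G, hG, h⟩ := ih
    have hZ := cliqueFree_zykov (ι := Fin ((r + 1) * N)) (κ := Fin p) (by omega) (by simp) hG
    let e := SimpleGraph.Iso.comap (Fintype.equivFin _).symm
      (zykov (ι := Fin ((r + 1) * N)) (κ := Fin p) G)
    exact ⟨_, _, hZ.comap e.isContained, h.zykov.of_embedding e.symm.toEmbedding⟩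

theorem exists_folkman {p r : ℕ} (hp : 2 ≤ p) (hr : 2 ≤ r) :
    ∃ G : SimpleGraph (Fin (folkman (List.replicate r 2 ++ [p]) (r + p - 1))),
      G.CliqueFree (r + p - 1) ∧ TwosArrow G r p := by
  obtain ⟨N, G, hG, h⟩ := exists_twosArrow hp r
  obtain ⟨G', hG', h'⟩ := Nat.sInf_mem (s := {n : ℕ | ∃ G : SimpleGraph (Fin n),
    G.CliqueFree (r + p - 1) ∧ VArrow G (List.replicate r 2 ++ [p])})
    ⟨N, G, hG.mono (by omega), vArrow_iff_twosArrow.2 h⟩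
  exact ⟨G', hG', vArrow_iff_twosArrow.1 h'⟩

theorem folkman_succ_le {p r : ℕ} (hp : 2 ≤ p) (hr : 2 ≤ r) :
    folkman (List.replicate (r + 1) 2 ++ [p]) (r + 1 + p - 1) ≤
      folkman (List.replicate r 2 ++ [p]) (r + p - 1) + 1 := by
  obtain ⟨G, hG, h⟩ := exists_folkman hp hr
  have := h.cone.folkman_le (cliqueFree_cone hG)
  rwa [Fintype.card_option, Fintype.card_fin, show r + p - 1 + 1 = r + 1 + p - 1 by omega] at this

theorem TwosArrow.induce {V : Type*} {G : SimpleGraph V} {r p : ℕ} (h : TwosArrow G (r + 1) p)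
    {A : Set V} (hA : G.IsIndepSet A) : TwosArrow (G.induce Aᶜ) r p := by
  classical
  intro c
  rcases h fun v => if hv : v ∈ A then r else if c ⟨v, hv⟩ < r then c ⟨v, hv⟩ else r + 1 with
    ⟨u, v, huv, h1, h2⟩ | ⟨s, hs, h1⟩
  · by_cases hu : u ∈ A <;> by_cases hv : v ∈ A <;> simp only [hu, hv, dif_pos, dif_neg,
      not_false_eq_true] at h1 h2
    · exact absurd huv (hA hu hv huv.ne)
    · split_ifs at h1 <;> omega
    · split_ifs at h1 <;> omega
    · refine Or.inl ⟨⟨u, hu⟩, ⟨v, hv⟩, huv, ?_⟩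
      split_ifs at h1 h2 <;> omega
  · have hsA : ∀ v ∈ s, ∃ hv : v ∈ Aᶜ, r ≤ c ⟨v, hv⟩ := by
      intro v hv
      have := h1 v hv
      split_ifs at this with h2 h3
      · omega
      · omega
      · exact ⟨h2, by omega⟩
    refine Or.inr ⟨s.subtype (· ∈ Aᶜ), ⟨?_, ?_⟩, ?_⟩
    · intro u hu v hv huv
      simp only [Finset.mem_coe, Finset.mem_subtype] at hu hv
      exact hs.isClique hu hv fun h => huv (Subtype.ext h)
    · rw [Finset.card_subtype, Finset.filter_true_of_mem fun v hv => (hsA v hv).1, hs.card_eq]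
    · intro v hv
      exact (hsA v (Finset.mem_subtype.1 hv)).2

theorem exists_clique_disjoint {V : Type*} [Fintype V] {G : SimpleGraph V} {r p q : ℕ}
    (h : TwosArrow G (r + 1) p)
    (hV : Fintype.card V ≤ folkman (List.replicate r 2 ++ [p]) q) {K : Finset V} (hK : K.Nonempty)
    (hKi : G.IsIndepSet (K : Set V)) :
    ∃ I : Finset V, G.IsClique (I : Set V) ∧ I.card = q ∧ Disjoint I K := by
  classical
  by_contra! hcon
  have hfree : (G.induce (K : Set V)ᶜ).CliqueFree q := by
    intro s hs
    refine hcon (s.map (Function.Embedding.subtype _)) ?_ (by simpa using hs.card_eq) ?_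
    · intro u hu v hv huv
      simp only [Finset.coe_map, Set.mem_image] at hu hv
      obtain ⟨u, hu, rfl⟩ := hu
      obtain ⟨v, hv, rfl⟩ := hv
      exact hs.isClique hu hv fun h => huv (h ▸ rfl)
    · rw [Finset.disjoint_left]
      intro v hv
      obtain ⟨u, -, rfl⟩ := Finset.mem_map.1 hv
      exact u.2
  have h1 := (h.induce hKi).folkman_le hfree
  obtain ⟨v, hv⟩ := hK
  have h2 : Fintype.card ↥((K : Set V)ᶜ) < Fintype.card V :=
    Fintype.card_subtype_lt (x := v) (by simpa using hv)
  omega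

theorem folkman_lower {p : ℕ} (hp : 3 ≤ p)
    (h : folkman (List.replicate 2 2 ++ [p]) (2 + p - 1) ≤ 2 * p + 5) {r : ℕ} (hr : 2 ≤ r) :
    folkman (List.replicate 2 2 ++ [p]) (2 + p - 1) + r ≤
      folkman (List.replicate r 2 ++ [p]) (r + p - 1) + 2 := by
  classical
  induction r, hr using Nat.le_induction with
  | base => rfl
  | succ r hr ih =>
    by_contra! hlt
    obtain ⟨G, hG, hA⟩ := exists_folkman (p := p) (r := r + 1) (by omega) (by omega)
    have hV := Fintype.card_fin (folkman (List.replicate (r + 1) 2 ++ [p]) (r + 1 + p - 1))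
    generalize folkman (List.replicate (r + 1) 2 ++ [p]) (r + 1 + p - 1) = N at *
    have hne := hA.nonempty (by omega)
    have hdis := fun (K : Finset (Fin N)) => exists_clique_disjoint (K := K) hA (q := r + p - 1)
      (by omega)
    obtain ⟨U, ⟨f, hf, hf'⟩, hU⟩ := exists_cover (H := Gᶜ) (n := r + p - 1) (r := r + 1) (by omega)
      (by omega) (by omega) (fun I hI => by
        rw [SimpleGraph.isIndepSet_compl] at hI
        by_contra! hcon
        exact hG.mono (by omega) I ⟨hI, rfl⟩) (fun K hK => by
        rw [SimpleGraph.isClique_compl] at hK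
        simp only [SimpleGraph.isIndepSet_compl]
        rcases K.eq_empty_or_nonempty with rfl | hKn
        · obtain ⟨v⟩ := hne
          obtain ⟨I, h1, h2, -⟩ := hdis {v} (by simp) (by simp)
          exact ⟨I, h1, h2, by simp⟩
        · exact hdis K hKn hK)
    rcases hA fun v => if v ∈ U then f v else r + 1 with ⟨u, v, huv, h1, h2⟩ | ⟨s, hs, hc⟩
    · by_cases hu : u ∈ U <;> by_cases hv : v ∈ U <;> simp only [hu, hv, if_true, if_false] at h1 h2
      · exact (hf' u hu v hv huv.ne h1).2 huv
      all_goals omega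
    · have h1 := hU s (by
        rw [SimpleGraph.isIndepSet_compl]
        exact hs.isClique)
      rw [Finset.inter_eq_left.2, hs.card_eq] at h1
      · omega
      · intro v hv
        have h2 := hc v hv
        by_cases hvU : v ∈ U
        · have := hf v hvU
          simp only [hvU, if_true] at h2
          omega
        · simp [hvU]

theorem folkman_upper {p r : ℕ} (hp : 2 ≤ p) (hr : 2 ≤ r) :
    folkman (List.replicate r 2 ++ [p]) (r + p - 1) + 2 ≤
      folkman (List.replicate 2 2 ++ [p]) (2 + p - 1) + r := by
  induction r, hr using Nat.le_induction with
  | base => rfl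
  | succ r hr ih =>
    have := folkman_succ_le hp hr
    omega

end VertexFolkman

/-- If `F_v(2, 2, p; p + 1) ≤ 2p + 5` then for all `r ≥ 2`,
`F_v(2_r, p; r + p − 1) = F_v(2, 2, p; p + 1) + r − 2`. -/
theorem folkman_twos_p_of_small (p : ℕ) (hp : 3 ≤ p)
    (h : folkman [2, 2, p] (p + 1) ≤ 2 * p + 5) :
    ∀ r : ℕ, 2 ≤ r →
      folkman (List.replicate r 2 ++ [p]) (r + p - 1) = folkman [2, 2, p] (p + 1) + r - 2 := by
  intro r hr
  have e : folkman (List.replicate 2 2 ++ [p]) (2 + p - 1) = folkman [2, 2, p] (p + 1) := by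
    rw [show 2 + p - 1 = p + 1 by omega]
    rfl
  have h1 := VertexFolkman.folkman_lower hp (by omega) hr
  have h2 := VertexFolkman.folkman_upper (p := p) (by omega) hr
  omega
end

section
/- Let G be a graph with G →v (a_1, …, a_s), let i ∈ {1, …, s}, and let t be an integer with a_i ≥ t ≥ 2. Then G →v (a_1, …, a_{i−1}, t, a_i − t + 1, a_{i+1}, …, a_s). -/
/-- A clique contains cliques of every smaller size. -/
theorem SimpleGraph.IsClique.exists_subset_isNClique {V : Type*} {G : SimpleGraph V}
    {s : Finset V} (hs : G.IsClique (s : Set V)) {n : ℕ} (hn : n ≤ s.card) :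
    ∃ u ⊆ s, G.IsNClique n u := by
  obtain ⟨u, hus, hu⟩ := Finset.exists_subset_card_eq hn
  exact ⟨u, hus, hs.subset (Finset.coe_subset.mpr hus), hu⟩

/-- If `G →v (a₁, …, aₛ)` and `aᵢ ≥ t ≥ 2`, then
`G →v (a₁, …, a_{i−1}, t, aᵢ − t + 1, a_{i+1}, …, aₛ)`. -/
theorem varrow_split_entry {V : Type*} (G : SimpleGraph V) (a : List ℕ)
    (hpos : ∀ x ∈ a, 0 < x) (hG : VArrow G a)
    (i : Fin a.length) (t : ℕ) (ht2 : 2 ≤ t) (hta : t ≤ a.get i) :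
    VArrow G (a.take i ++ t :: (a.get i - t + 1) :: a.drop (i + 1)) := by
  classical
  have hi := i.isLt
  set L := a.take i ++ t :: (a.get i - t + 1) :: a.drop (i + 1) with hL
  have hlen : L.length = a.length + 1 := by
    simp [hL]
    omega
  intro c
  have hlt (v : V) : (c v : ℕ) < a.length + 1 := hlen ▸ (c v).isLt
  -- Identify the two new colors.
  obtain ⟨j, s, hs, hc⟩ := hG fun v =>
    ⟨if (c v : ℕ) ≤ i then c v else c v - 1, by have := hlt v; split_ifs <;> omega⟩
  have hc' : ∀ v ∈ s, (if (c v : ℕ) ≤ i then (c v : ℕ) else c v - 1) = j :=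
    fun v hv => congrArg Fin.val (hc v hv)
  have key (k : ℕ) (hk : k < L.length)
      (hcard : L[k] ≤ (s.filter fun v => (c v : ℕ) = k).card) :
      ∃ k : Fin L.length, ∃ u : Finset V, G.IsNClique (L.get k) u ∧ ∀ v ∈ u, c v = k := by
    have hcl : G.IsClique (s.filter fun v => (c v : ℕ) = k : Finset V) :=
      hs.isClique.subset (Finset.coe_subset.mpr (Finset.filter_subset _ _))
    obtain ⟨u, hus, hu⟩ := hcl.exists_subset_isNClique hcard
    exact ⟨⟨k, hk⟩, u, hu, fun v hv => Fin.ext (Finset.mem_filter.mp (hus hv)).2⟩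
  have hj := j.isLt
  have hscard : s.card = a[(j : ℕ)] := hs.card_eq
  rcases lt_trichotomy (j : ℕ) i with hji | hji | hji
  · refine key j (by omega) ?_
    rw [Finset.filter_true_of_mem, hscard]
    · simp [hL, hji]
    · intro v hv
      have := hc' v hv
      split_ifs at this <;> omega
  · have hsplit : (s.filter fun v => (c v : ℕ) = i).card +
        (s.filter fun v => (c v : ℕ) = i + 1).card = a.get i := by
      have hs' : s.card = a.get i := by
        rw [← Fin.ext hji]
        exact hscard
      rw [← hs', ← Finset.card_filter_add_card_filter_not (s := s) (fun v => (c v : ℕ) = i)]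
      congr 2
      refine Finset.filter_congr fun v hv => ?_
      have := hc' v hv
      split_ifs at this <;> omega
    by_cases h : t ≤ (s.filter fun v => (c v : ℕ) = i).card
    · refine key i (by omega) ?_
      simpa [hL, List.getElem_append, hi.le] using h
    · refine key (i + 1) (by omega) ?_
      have hLi : L[(i : ℕ) + 1]'(by omega) = a.get i - t + 1 := by
        simp [hL, hi.le]
      omega
  · refine key (j + 1) (by omega) ?_
    rw [Finset.filter_true_of_mem, hscard]
    · obtain ⟨m, hm⟩ := Nat.exists_eq_add_of_lt hji
      have hsub : (j : ℕ) + 1 - i = m + 2 := by omega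
      have hnot : ¬ (j : ℕ) + 1 < i := by omega
      have hidx : (i : ℕ) + 1 + m = j := by omega
      simp [hL, List.getElem_append, hi.le, hsub, hnot, hidx]
    · intro v hv
      have := hc' v hv
      split_ifs at this <;> omega
end

section
/- Let G be a graph, let A ⊆ V(G) be an independent set, let H = G − A, and let t be a positive integer. Then α(G) ≤ t if and only if for every subset A' ⊆ A one has α(H − ⋃_{v ∈ A'} N_G(v)) ≤ t − |A'|, where H − S denotes the subgraph of H induced by V(H) \ S. -/
/-- For an independent set `A` of `G` and `H = G − A`: `α(G) ≤ t` iff for every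
`A' ⊆ A` one has `α(H − ⋃_{v ∈ A'} N_G(v)) ≤ t − |A'|`. -/
theorem indepNum_le_iff_subsets {V : Type*} [Fintype V] [DecidableEq V]
    (G : SimpleGraph V) (A : Finset V) (hA : ∀ v ∈ A, ∀ w ∈ A, ¬ G.Adj v w)
    (t : ℕ) (ht : 1 ≤ t) :
    (∀ B : Finset V, (∀ x ∈ B, ∀ y ∈ B, ¬ G.Adj x y) → B.card ≤ t) ↔
      ∀ A' ⊆ A, ∀ B : Finset V,
        (∀ x ∈ B, x ∉ A) →
        (∀ x ∈ B, ∀ v ∈ A', ¬ G.Adj v x) →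
        (∀ x ∈ B, ∀ y ∈ B, ¬ G.Adj x y) →
        (B.card : ℤ) ≤ (t : ℤ) - A'.card := by
  constructor
  · intro h A' hA' B hBA hBA' hB
    have hdisj : Disjoint B A' :=
      Finset.disjoint_left.mpr fun x hxB hxA' => hBA x hxB (hA' hxA')
    have hcard : (B ∪ A').card ≤ t := by
      refine h _ fun x hx y hy => ?_
      rcases Finset.mem_union.mp hx with hx | hx <;> rcases Finset.mem_union.mp hy with hy | hy
      · exact hB x hx y hy
      · exact fun hxy => hBA' x hx y hy hxy.symm
      · exact hBA' y hy x hx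
      · exact hA x (hA' hx) y (hA' hy)
    rw [Finset.card_union_of_disjoint hdisj] at hcard
    lia
  · intro h B hB
    have hcard := h (B ∩ A) Finset.inter_subset_right (B \ A)
      (fun x hx => (Finset.mem_sdiff.mp hx).2)
      (fun x hx v hv => hB v (Finset.mem_inter.mp hv).1 x (Finset.mem_sdiff.mp hx).1)
      (fun x hx y hy => hB x (Finset.mem_sdiff.mp hx).1 y (Finset.mem_sdiff.mp hy).1)
    have hsum := Finset.card_sdiff_add_card_inter B A
    lia
end

section
/- Let p ≥ 2 and let G be a graph with clique number ω(G) < p + 1 such that G →v (2, 2, p). Then for every vertex v of G, the subgraph of G induced by the set of vertices distinct from v and not adjacent to v has chromatic number greater than 2. In particular, the maximum degree satisfies Δ(G) ≤ |V(G)| − 4. -/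
/-- If the non-neighbors of `v` can be properly colored with two colors in a `K_{p+1}`-free graph,
then coloring `v` like a non-neighbor and its neighbors with a third color shows that `G` does not
arrow `(2, 2, p)`. -/
theorem not_vArrow_of_nonNbhd_colorable {V : Type*} {p : ℕ} {G : SimpleGraph V}
    (hfree : G.CliqueFree (p + 1)) (v : V)
    (hcol : (G.induce {w : V | w ≠ v ∧ ¬ G.Adj v w}).Colorable 2) :
    ¬ VArrow G [2, 2, p] := by
  classical
  intro hG
  obtain ⟨C⟩ := hcol
  let c : V → Fin 3 := fun w ↦
    if h : w ≠ v ∧ ¬ G.Adj v w then (C ⟨w, h⟩).castSucc else if w = v then 0 else 2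
  have c_self : c v = 0 := by simp [c]
  have c_nbr {w : V} : c w = 2 → G.Adj v w := by
    by_cases h : w ≠ v ∧ ¬ G.Adj v w
    · simp only [c, dif_pos h]
      generalize C ⟨w, h⟩ = i
      fin_cases i <;> simp
    · by_cases hw : w = v
      · simp [hw, c_self]
      · intro _
        simpa [hw] using h
  have c_proper {x y : V} (hxy : G.Adj x y) (hc : c x = c y) : c x = 2 := by
    by_cases hx : x ≠ v ∧ ¬ G.Adj v x
    · by_cases hy : y ≠ v ∧ ¬ G.Adj v y
      · have hC : C ⟨x, hx⟩ ≠ C ⟨y, hy⟩ := C.valid hxy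
        simp only [c, dif_pos hx, dif_pos hy] at hc
        exact (hC (Fin.castSucc_injective _ hc)).elim
      · by_cases hyv : y = v
        · exact (hx.2 (hyv ▸ hxy.symm)).elim
        · rw [hc]
          simp only [c, dif_neg hy, if_neg hyv]
    · by_cases hxv : x = v
      · subst hxv
        by_cases hy : y ≠ x ∧ ¬ G.Adj x y
        · exact (hy.2 hxy).elim
        · rw [hc]
          simp only [c, dif_neg hy, if_neg hxy.ne']
      · simp only [c, dif_neg hx, if_neg hxv]
  have no_edge {i : Fin 3} (hi : i ≠ 2) {s : Finset V} (hs : G.IsNClique 2 s)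
      (hc : ∀ w ∈ s, c w = i) : False := by
    obtain ⟨x, y, hxy, rfl⟩ := Finset.card_eq_two.mp hs.card_eq
    have hx : c x = i := hc x (by simp)
    have hy : c y = i := hc y (by simp)
    have hadj : G.Adj x y := hs.isClique (by simp) (by simp) hxy
    exact hi (hx ▸ c_proper hadj (hx.trans hy.symm))
  obtain ⟨i, s, hs, hc⟩ := hG c
  fin_cases i
  · exact no_edge (i := 0) (by decide) hs hc
  · exact no_edge (i := 1) (by decide) hs hc
  · exact hfree _ (SimpleGraph.IsNClique.insert hs fun w hw ↦ c_nbr (hc w hw))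

/-- If `ω(G) < p + 1` and `G →v (2, 2, p)`, then for every vertex `v` the non-neighbors
of `v` induce a graph of chromatic number greater than `2`; in particular
`Δ(G) ≤ |V(G)| − 4`. -/
theorem nonNbhd_chromatic_gt_two {V : Type*} [Fintype V] [DecidableEq V]
    (p : ℕ) (hp : 2 ≤ p) (G : SimpleGraph V) [DecidableRel G.Adj]
    (hfree : G.CliqueFree (p + 1)) (hG : VArrow G [2, 2, p]) :
    (∀ v : V, (2 : ℕ∞) < (G.induce {w : V | w ≠ v ∧ ¬ G.Adj v w}).chromaticNumber) ∧
      G.maxDegree ≤ Fintype.card V - 4 := by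
  classical
  have hchrom (v : V) :
      (2 : ℕ∞) < (G.induce {w : V | w ≠ v ∧ ¬ G.Adj v w}).chromaticNumber := by
    by_contra! h
    exact not_vArrow_of_nonNbhd_colorable hfree v
      (SimpleGraph.chromaticNumber_le_iff_colorable.mp h) hG
  refine ⟨hchrom, SimpleGraph.maxDegree_le_of_forall_degree_le _ _ fun v ↦ ?_⟩
  have hcard : 2 < Fintype.card {w : V | w ≠ v ∧ ¬ G.Adj v w} := by
    by_contra! h
    exact (hchrom v).not_ge <| SimpleGraph.chromaticNumber_le_iff_colorable.mpr <|
      (SimpleGraph.colorable_of_fintype _).mono h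
  have hcompl : Fintype.card {w : V | w ≠ v ∧ ¬ G.Adj v w} = Gᶜ.degree v := by
    rw [← SimpleGraph.card_neighborSet_eq_degree]
    exact Fintype.card_congr (Equiv.setCongr (by ext w; simp [SimpleGraph.compl_adj, eq_comm]))
  have hsum := G.degree_compl (v := v)
  have := G.degree_lt_card_verts v
  omega
end
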